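/- A two-dimensional Artin group A_S contains no subgroup isomorphic to ℤ × ℤ × ℤ; that is, every abelian subgroup of A_S has rank at most 2. -/

import Mathlib

open scoped ENNReal

/-- The alternating word `s t s t ⋯` of length `m`. -/
def altWord {G : Type*} [Monoid G] (s t : G) : ℕ → G
  | 0 => 1
  | n + 1 => s * altWord t s n

/-- The Artin relations associated to a matrix of exponents `M : S → S → ℕ∞`:
for each pair `s ≠ t` with `M s t = n < ∞`, the relation
`prod(s,t;n) = prod(t,s;n)`. -/
def artinRels {S : Type*} (M : S → S → ℕ∞) : Set (FreeGroup S) :=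
  { w | ∃ s t : S, s ≠ t ∧ ∃ n : ℕ, M s t = (n : ℕ∞) ∧
      w = altWord (FreeGroup.of s) (FreeGroup.of t) n *
        (altWord (FreeGroup.of t) (FreeGroup.of s) n)⁻¹ }

/-- The Artin group with generating set `S` and exponents `M`. -/
abbrev ArtinGroup {S : Type*} (M : S → S → ℕ∞) := PresentedGroup (artinRels M)

/-- The Artin group is two-dimensional if `1/m_{st} + 1/m_{tr} + 1/m_{sr} ≤ 1` for all
pairwise distinct `s, t, r ∈ S` (with the convention `1/∞ = 0`). -/
def TwoDimensional {S : Type*} (M : S → S → ℕ∞) : Prop :=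
  ∀ s t r : S, s ≠ t → t ≠ r → s ≠ r →
    ((M s t : ℝ≥0∞))⁻¹ + ((M t r : ℝ≥0∞))⁻¹ + ((M s r : ℝ≥0∞))⁻¹ ≤ 1

set_option linter.all false

namespace Cox
open Real Polynomial.Chebyshev
variable {S : Type*} [Fintype S] [DecidableEq S] (M : CoxeterMatrix S)

/-- The coefficients of the geometric representation. -/
noncomputable def kk (s t : S) : ℝ := 2 * cos (π / (M s t : ℝ))

lemma kk_self (s : S) : kk M s s = -2 := by simp [kk]

lemma kk_symm (s t : S) : kk M s t = kk M t s := by simp [kk, M.symmetric s t]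

/-- The linear form attached to a generator. -/
noncomputable def fs (s : S) : (S → ℝ) →ₗ[ℝ] ℝ :=
  -∑ t, kk M s t • LinearMap.proj t

/-- The simple root. -/
noncomputable def al (s : S) : S → ℝ := Pi.single s 1

lemma fs_al (s t : S) : fs M s (al t) = - kk M s t := by
  simp [fs, al, Pi.single_apply]

lemma fs_al_self (s : S) : fs M s (al s) = 2 := by
  rw [fs_al, kk_self]; norm_num

/-- The reflection. -/
noncomputable def refl (s : S) : (S → ℝ) ≃ₗ[ℝ] (S → ℝ) := Module.reflection (fs_al_self M s)

lemma refl_apply (s : S) (v : S → ℝ) : refl M s v = v - fs M s v • al s :=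
  Module.reflection_apply _ _

lemma refl_pow {s t : S} (hst : s ≠ t) (h0 : M s t ≠ 0) : (refl M s * refl M t) ^ (M s t) = 1 := by
  set m := M s t with hm
  have hm1 : m ≠ 1 := fun h => M.off_diagonal s t hst h
  have hm0 : (0 : ℝ) < m := by positivity
  ext1 z
  unfold refl
  rw [Module.reflection_mul_reflection_pow_apply (fs_al_self M s) (fs_al_self M t) m z _ rfl]
  rw [fs_al, fs_al, kk_symm M t s]
  have htt : (-kk M s t) * (-kk M s t) - 2 = 2 * cos (2 * (π / m)) := by
    rw [cos_two_mul, kk]; ring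
  rw [htt]
  have hS := fun n : ℤ => S_two_mul_real_cos (2 * (π / m)) n
  by_cases hm2 : m = 2
  · have : kk M s t = 0 := by
      rw [kk, ← hm, hm2]; simp
    rw [this, hm2]
    have h2 : (2 * cos (2 * (π / ((2:ℕ):ℝ)))) = -2 := by
      rw [show 2 * (π / ((2:ℕ):ℝ)) = π by push_cast; ring]; simp
    rw [h2]
    norm_num
    module
  · have hsin : sin (2 * (π / m)) ≠ 0 := by
      apply ne_of_gt
      apply sin_pos_of_pos_of_lt_pi (by positivity)
      have : (3 : ℝ) ≤ m := by
        have : 3 ≤ m := by omega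
        exact_mod_cast this
      rw [show 2 * (π / m) = π * (2 / m) by ring]
      have : (2 : ℝ) / m < 1 := by rw [div_lt_one hm0]; linarith
      nlinarith [pi_pos]
    rcases Nat.even_or_odd' m with ⟨q, hq | hq⟩
    · have e1 : ((m : ℤ) - 2) / 2 = q - 1 := by omega
      have e2 : ((m : ℤ) - 1) / 2 = q - 1 := by omega
      have h0 : Polynomial.eval (2 * cos (2 * (π / m))) (Polynomial.Chebyshev.S ℝ (q - 1)) = 0 := by
        have := hS (q - 1)
        have e : ((((q:ℤ) - 1 : ℤ) : ℝ) + 1) * (2 * (π / m)) = π := by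
          have : (m : ℝ) = 2 * q := by exact_mod_cast hq
          push_cast
          field_simp
          rw [this]; ring
        rw [e, sin_pi] at this
        exact (mul_eq_zero.mp this).resolve_right hsin
      rw [e1, e2, h0]; simp
    · have e1 : ((m : ℤ) - 2) / 2 = q - 1 := by omega
      have e2 : ((m : ℤ) - 1) / 2 = q := by omega
      have e3 : ((m : ℤ) - 3) / 2 = q - 1 := by omega
      have e4 : (m : ℤ) / 2 = q := by omega
      have h0 : Polynomial.eval (2 * cos (2 * (π / m))) (Polynomial.Chebyshev.S ℝ q)
        + Polynomial.eval (2 * cos (2 * (π / m))) (Polynomial.Chebyshev.S ℝ (q - 1)) = 0 := by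
        have h1 := hS (q - 1)
        have h2 := hS q
        have hmq : (m : ℝ) = 2 * q + 1 := by exact_mod_cast hq
        have e : ((((q:ℤ) - 1 : ℤ) : ℝ) + 1) * (2 * (π / m)) = π - π / m := by
          push_cast
          field_simp
          rw [hmq]; ring
        have e' : ((((q:ℤ) : ℤ) : ℝ) + 1) * (2 * (π / m)) = π / m + π := by
          push_cast
          field_simp
          rw [hmq]; ring
        rw [e, sin_pi_sub] at h1
        rw [e', sin_add_pi] at h2
        have : (Polynomial.eval (2 * cos (2 * (π / m))) (Polynomial.Chebyshev.S ℝ q)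
        + Polynomial.eval (2 * cos (2 * (π / m))) (Polynomial.Chebyshev.S ℝ (q - 1))) * sin (2 * (π / m)) = 0 := by
          rw [add_mul, h1, h2]; ring
        exact (mul_eq_zero.mp this).resolve_right hsin
      rw [e1, e2, e3, e4, h0]; simp

lemma refl_liftable : M.IsLiftable (refl M) := by
  intro s t
  by_cases hst : s = t
  · subst hst
    rw [M.diagonal, pow_one]
    ext1 z
    simp [refl, Module.involutive_reflection (fs_al_self M s) z]
  · by_cases h0 : M s t = 0
    · rw [h0, pow_zero]
    · exact refl_pow M hst h0

end Cox

namespace Cox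
open Real
variable {S : Type*} [Fintype S] [DecidableEq S] {M : CoxeterMatrix S}
variable {W : Type*} [Group W] (cs : CoxeterSystem M W)

/-- The geometric representation. -/
noncomputable def rho : W →* ((S → ℝ) ≃ₗ[ℝ] (S → ℝ)) := cs.lift ⟨refl M, refl_liftable M⟩

lemma rho_simple (s : S) : rho cs (cs.simple s) = refl M s := cs.lift_apply_simple _ _

lemma rho_mul_simple (w : W) (s : S) (v : S → ℝ) :
    rho cs (w * cs.simple s) v = rho cs w v - fs M s v • rho cs w (al s) := by
  rw [map_mul, rho_simple, LinearEquiv.mul_apply, refl_apply, map_sub, map_smul]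

/-- Product of the alternating word of length `j` ending in `t`. -/
def P (s t : S) (j : ℕ) : W := cs.wordProd (CoxeterSystem.alternatingWord s t j)

lemma P_zero (s t : S) : P cs s t 0 = 1 := by simp [P, CoxeterSystem.alternatingWord]

lemma P_succ (s t : S) (j : ℕ) : P cs s t (j+1) = P cs t s j * cs.simple t := by
  simp [P, CoxeterSystem.alternatingWord_succ, cs.wordProd_append]

lemma P_mul (s t : S) (j : ℕ) : P cs t s (j+1) * cs.simple s = P cs s t j := by
  rw [P_succ]; simp

lemma length_P_le (s t : S) (j : ℕ) : cs.length (P cs s t j) ≤ j := by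
  have := cs.length_wordProd_le (CoxeterSystem.alternatingWord s t j)
  simpa [P] using this

lemma P_reduced {s t : S} {j : ℕ} (hM : M s t ≠ 0) (h : j ≤ cs.length (P cs s t j)) :
    j ≤ M s t := by
  by_contra hc
  apply cs.not_isReduced_alternatingWord s t hM (m := j) (by omega)
  have := length_P_le cs s t j
  unfold CoxeterSystem.IsReduced
  simp only [CoxeterSystem.length_alternatingWord]
  exact le_antisymm this h

lemma P_longest (s t : S) : P cs s t (M s t) = P cs t s (M s t) := by
  have := cs.prod_alternatingWord_eq_prod_alternatingWord_sub s t (M s t) (by omega)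
  rw [show M s t * 2 - M s t = M s t by omega] at this
  exact this

lemma dec (w : W) (s t : S) (h : ¬ cs.IsRightDescent w s) :
    ∃ v j, w = v * P cs s t j ∧ cs.length w = cs.length v + j ∧
      ¬ cs.IsRightDescent v s ∧ ¬ cs.IsRightDescent v t := by
  induction hn : cs.length w generalizing w s t with
  | zero =>
    refine ⟨w, 0, by simp [P_zero], by omega, h, ?_⟩
    rw [cs.isRightDescent_iff]; omega
  | succ n ih =>
    by_cases ht : cs.IsRightDescent w t
    · obtain ⟨v, j, h1, h2, h3, h4⟩ := ih (w * cs.simple t) t s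
        (cs.isRightDescent_iff_not_isRightDescent_mul.mp ht)
        (by rw [cs.isRightDescent_iff] at ht; omega)
      refine ⟨v, j+1, ?_, by omega, h4, h3⟩
      rw [P_succ, ← mul_assoc, ← h1]; simp
    · exact ⟨w, 0, by simp [P_zero], by omega, h, ht⟩

/-- Chebyshev-like sequence. -/
noncomputable def ee (k : ℝ) : ℕ → ℝ
  | 0 => 0
  | 1 => 1
  | n + 2 => k * ee k (n+1) - ee k n

lemma ee_sin (θ : ℝ) (n : ℕ) : ee (2 * cos θ) n * sin θ = sin (n * θ) := by
  induction n using Nat.twoStepInduction with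
  | zero => simp [ee]
  | one => simp [ee]
  | more n ih1 ih2 =>
    rw [ee, sub_mul, mul_assoc, ih2, ih1]
    push_cast
    rw [show ((n:ℝ)+1) * θ = n * θ + θ by ring, show ((n:ℝ)+2) * θ = (n * θ + θ) + θ by ring,
      sin_add (n * θ + θ), sin_add, cos_add]
    have := sin_sq_add_cos_sq θ
    linear_combination (sin (n * θ)) * this

lemma ee_two (n : ℕ) : ee 2 n = n := by
  induction n using Nat.twoStepInduction with
  | zero => simp [ee]
  | one => simp [ee]
  | more n ih1 ih2 => rw [ee, ih1, ih2]; push_cast; ring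

lemma ee_nonneg {s t : S} (hst : s ≠ t) {j : ℕ} (h : M s t ≠ 0 → j ≤ M s t) :
    0 ≤ ee (kk M s t) j := by
  by_cases h0 : M s t = 0
  · have : kk M s t = 2 := by simp [kk, h0]
    rw [this, ee_two]; positivity
  · have hm1 : M s t ≠ 1 := M.off_diagonal s t hst
    have hm0 : (0:ℝ) < M s t := by positivity
    have h2 : (2:ℝ) ≤ M s t := by
      have : 2 ≤ M s t := by omega
      exact_mod_cast this
    have hsin : 0 < sin (π / M s t) := by
      apply sin_pos_of_pos_of_lt_pi (by positivity)
      rw [div_lt_iff₀ hm0]; nlinarith [pi_pos]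
    have h1 := ee_sin (π / M s t) j
    have h3 : 0 ≤ sin (j * (π / M s t)) := by
      apply sin_nonneg_of_nonneg_of_le_pi (by positivity)
      have : (j:ℝ) ≤ M s t := by exact_mod_cast h h0
      rw [← mul_div_assoc, div_le_iff₀ hm0]; nlinarith [pi_pos]
    rw [← h1] at h3
    exact nonneg_of_mul_nonneg_left h3 hsin

lemma ee_pos {s t : S} (hst : s ≠ t) {j : ℕ} (hj : 0 < j) (h : M s t ≠ 0 → j < M s t) :
    0 < ee (kk M s t) j := by
  by_cases h0 : M s t = 0
  · have : kk M s t = 2 := by simp [kk, h0]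
    rw [this, ee_two]; positivity
  · have hm1 : M s t ≠ 1 := M.off_diagonal s t hst
    have hm0 : (0:ℝ) < M s t := by positivity
    have h2 : (2:ℝ) ≤ M s t := by
      have : 2 ≤ M s t := by omega
      exact_mod_cast this
    have hsin : 0 < sin (π / M s t) := by
      apply sin_pos_of_pos_of_lt_pi (by positivity)
      rw [div_lt_iff₀ hm0]; nlinarith [pi_pos]
    have h1 := ee_sin (π / M s t) j
    have h3 : 0 < sin (j * (π / M s t)) := by
      apply sin_pos_of_pos_of_lt_pi (by positivity)
      have : (j:ℝ) < M s t := by exact_mod_cast h h0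
      rw [← mul_div_assoc, div_lt_iff₀ hm0]; nlinarith [pi_pos]
    rw [← h1] at h3
    exact pos_of_mul_pos_left h3 hsin.le

lemma rho_P (s t : S) (j : ℕ) :
    rho cs (P cs s t j) (al s) =
      ee (kk M s t) (j+1) • al (if Even j then s else t) +
      ee (kk M s t) j • al (if Even j then t else s) := by
  induction j using Nat.twoStepInduction generalizing s t with
  | zero => simp [P_zero, ee]
  | one =>
    simp [P_succ, P_zero, ee, rho_simple, refl_apply, fs_al, kk_symm M t s, add_comm]
  | more n ih1 ih2 =>
    rw [P_succ, rho_mul_simple, P_succ, rho_mul_simple, ← P_succ, ih1 s t, ih2 t s, fs_al_self,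
      fs_al, kk_symm M t s]
    have : ee (kk M s t) (n+2+1) = kk M s t * ee (kk M s t) (n+2) - ee (kk M s t) (n+1) := rfl
    have h' : ee (kk M s t) (n+2) = kk M s t * ee (kk M s t) (n+1) - ee (kk M s t) (n) := rfl
    by_cases hn : Even n
    · simp only [hn, this, h', Nat.even_add_one, not_true, if_true, if_false, not_false_iff]
      module
    · simp only [hn, this, h', Nat.even_add_one, not_true, if_true, if_false, not_false_iff]
      module

theorem rho_nonneg (w : W) (s : S) (h : ¬ cs.IsRightDescent w s) : 0 ≤ rho cs w (al s) := by
  induction hn : cs.length w using Nat.strong_induction_on generalizing w s with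
  | _ n ih =>
    by_cases hw : w = 1
    · subst hw
      simp [al]
    · obtain ⟨t, ht⟩ := cs.exists_rightDescent_of_ne_one hw
      have hst : s ≠ t := by rintro rfl; exact h ht
      obtain ⟨v, j, h1, h2, h3, h4⟩ := dec cs w s t h
      have hj : j ≠ 0 := by
        rintro rfl
        rw [P_zero, mul_one] at h1
        subst h1; exact h4 ht
      have hred : M t s ≠ 0 → j + 1 ≤ M t s := by
        intro h0
        apply P_reduced cs h0
        rw [cs.not_isRightDescent_iff] at h
        rw [h1, mul_assoc, ← P_succ] at h
        have := cs.length_mul_le v (P cs t s (j+1))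
        rw [← h1] at h
        omega
      have e1 : 0 ≤ ee (kk M s t) (j+1) := by
        rw [kk_symm]; exact ee_nonneg hst.symm hred
      have e2 : 0 ≤ ee (kk M s t) j := by
        rw [kk_symm]; exact ee_nonneg hst.symm (fun h => by have := hred h; omega)
      have hs := ih _ (by omega) v s h3 rfl
      have ht := ih _ (by omega) v t h4 rfl
      rw [h1, map_mul, LinearEquiv.mul_apply, rho_P, map_add, map_smul, map_smul]
      split_ifs
      · exact add_nonneg (smul_nonneg e1 hs) (smul_nonneg e2 ht)
      · exact add_nonneg (smul_nonneg e1 ht) (smul_nonneg e2 hs)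

theorem rho_nonpos (w : W) (s : S) (h : cs.IsRightDescent w s) : rho cs w (al s) ≤ 0 := by
  have h1 := rho_nonneg cs _ s (cs.isRightDescent_iff_not_isRightDescent_mul.mp h)
  rw [rho_mul_simple, fs_al_self] at h1
  intro i
  have := h1 i
  simp at this ⊢
  linarith

theorem two_descents {w : W} {s t : S} (hst : s ≠ t) (hs : cs.IsRightDescent w s)
    (ht : cs.IsRightDescent w t) :
    M s t ≠ 0 ∧ ∃ v, w = v * P cs s t (M s t) ∧ cs.length w = cs.length v + M s t := by
  obtain ⟨v, j, h1, h2, h3, h4⟩ := dec cs (w * cs.simple t) t s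
    (cs.isRightDescent_iff_not_isRightDescent_mul.mp ht)
  have hw : w = v * P cs s t (j+1) := by
    rw [P_succ, ← mul_assoc, ← h1]; simp
  have hl : cs.length w = cs.length v + (j+1) := by
    rw [cs.isRightDescent_iff] at ht; omega
  have key : ¬ (M s t ≠ 0 → j+1 < M s t) := by
    intro hlt
    have hneg := rho_nonpos cs w s hs
    have e1 : 0 ≤ ee (kk M s t) (j+1+1) := ee_nonneg hst (fun h => hlt h)
    have e2 : 0 < ee (kk M s t) (j+1) := ee_pos hst (by omega) hlt
    have hrs := rho_nonneg cs v s h4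
    have hrt := rho_nonneg cs v t h3
    have hz : rho cs w (al s) = 0 := by
      apply le_antisymm hneg
      rw [hw, map_mul, LinearEquiv.mul_apply, rho_P, map_add, map_smul, map_smul]
      split_ifs
      · exact add_nonneg (smul_nonneg e1 hrs) (smul_nonneg e2.le hrt)
      · exact add_nonneg (smul_nonneg e1 hrt) (smul_nonneg e2.le hrs)
    rw [LinearEquiv.map_eq_zero_iff] at hz
    have := congrFun hz s
    simp [al] at this
  push Not at key
  obtain ⟨h0, hle⟩ := key
  have : j + 1 ≤ M s t := by
    apply P_reduced cs h0
    have := cs.length_mul_le v (P cs s t (j+1))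
    rw [← hw] at this; omega
  have e : j + 1 = M s t := by omega
  exact ⟨h0, v, by rw [← e]; exact hw, by rw [← e]; exact hl⟩

/-- The coset of the parabolic subgroup generated by `s`, `t`. -/
def Kc (w : W) (s t : S) : Set W :=
  {u | w⁻¹ * u ∈ Subgroup.closure {cs.simple s, cs.simple t}}

lemma Kc_self (w : W) (s t : S) : w ∈ Kc cs w s t := by simp [Kc, one_mem]

lemma Kc_mul_left {w u : W} {s t : S} (h : u ∈ Kc cs w s t) : u * cs.simple s ∈ Kc cs w s t := by
  simp only [Kc, Set.mem_setOf_eq, ← mul_assoc] at *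
  exact mul_mem h (Subgroup.subset_closure (by simp))

lemma Kc_mul_right {w u : W} {s t : S} (h : u ∈ Kc cs w s t) : u * cs.simple t ∈ Kc cs w s t := by
  simp only [Kc, Set.mem_setOf_eq, ← mul_assoc] at *
  exact mul_mem h (Subgroup.subset_closure (by simp))

lemma Kc_symm {w u : W} {s t : S} (h : u ∈ Kc cs w s t) : w ∈ Kc cs u s t := by
  simp only [Kc, Set.mem_setOf_eq] at *
  have := inv_mem h
  simpa using this

lemma Kc_swap (w : W) (s t : S) : Kc cs w s t = Kc cs w t s := by
  unfold Kc; rw [Set.pair_comm]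

theorem coset_form {w v : W} {s t : S} (h0 : M s t ≠ 0) (hw : w = v * P cs s t (M s t))
    {u : W} (hu : u ∈ Kc cs w s t) :
    ∃ j ≤ M s t, u = v * P cs s t j ∨ u = v * P cs t s j := by
  have key : ∀ x ∈ Subgroup.closure {cs.simple s, cs.simple t}, ∀ y,
      (∃ j ≤ M s t, y = v * P cs s t j ∨ y = v * P cs t s j) →
      (∃ j ≤ M s t, y * x = v * P cs s t j ∨ y * x = v * P cs t s j) := by
    have step : ∀ a ∈ ({cs.simple s, cs.simple t} : Set W), ∀ y,
      (∃ j ≤ M s t, y = v * P cs s t j ∨ y = v * P cs t s j) →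
      (∃ j ≤ M s t, y * a = v * P cs s t j ∨ y * a = v * P cs t s j) := by
      intro a ha y ⟨j, hj, hy⟩
      have gen : ∀ (s t : S) (m : ℕ), m ≠ 0 → P cs s t m = P cs t s m → j ≤ m → 
          (y = v * P cs s t j ∨ y = v * P cs t s j) →
          ∃ j ≤ m, y * cs.simple s = v * P cs s t j ∨ y * cs.simple s = v * P cs t s j := by
        intro s t m hm hP hj hy
        have main : y = v * P cs t s j → j ≠ 0 → 
          ∃ j ≤ m, y * cs.simple s = v * P cs s t j ∨ y * cs.simple s = v * P cs t s j := by
          intro hy hj0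
          obtain ⟨i, rfl⟩ := Nat.exists_eq_succ_of_ne_zero hj0
          exact ⟨i, by omega, Or.inl (by rw [hy, mul_assoc, Nat.succ_eq_add_one, P_mul])⟩
        by_cases hjm : j = m
        · apply main _ (by omega)
          rcases hy with hy | hy
          · rw [hy, hjm, hP]
          · exact hy
        rcases hy with hy | hy
        · exact ⟨j+1, by omega, Or.inr (by rw [hy, mul_assoc, ← P_succ])⟩
        · by_cases hj0 : j = 0
          · subst hj0
            refine ⟨1, by omega, Or.inr (by rw [hy, P_succ, P_zero, P_zero]; simp)⟩
          · exact main hy hj0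
      rcases ha with rfl | rfl
      · exact gen s t _ h0 (P_longest cs s t) hj hy
      · obtain ⟨i, hi, h⟩ := gen t s _ h0 (P_longest cs s t).symm hj hy.symm
        exact ⟨i, hi, h.symm⟩
    have key2 : ∀ x ∈ Subgroup.closure {cs.simple s, cs.simple t}, ∀ y,
      (∃ j ≤ M s t, y = v * P cs s t j ∨ y = v * P cs t s j) ↔
      (∃ j ≤ M s t, y * x = v * P cs s t j ∨ y * x = v * P cs t s j) := by
      intro x hx
      induction hx using Subgroup.closure_induction with
      | mem a ha =>
        intro y
        refine ⟨step a ha y, fun h => ?_⟩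
        have := step a ha _ h
        have e : y * a * a = y := by rcases ha with rfl | rfl <;> simp
        rwa [e] at this
      | one => simp
      | mul a b _ _ iha ihb =>
        intro y
        rw [iha y, ihb (y * a), mul_assoc]
      | inv a ha iha =>
        intro y
        rw [iha (y * a⁻¹)]
        simp
    exact fun x hx y => (key2 x hx y).mp
  have := key _ hu w ⟨_, le_rfl, Or.inl hw⟩
  simpa using this

theorem coset_props {w : W} {s t : S} (hst : s ≠ t) (hs : cs.IsRightDescent w s)
    (ht : cs.IsRightDescent w t) :
    M s t ≠ 0 ∧ ∀ u ∈ Kc cs w s t, cs.length w ≤ cs.length u + M s t ∧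
      (u ≠ w → cs.length u < cs.length w ∧ ¬ (cs.IsRightDescent u s ∧ cs.IsRightDescent u t)) := by
  obtain ⟨h0, v, hw, hl⟩ := two_descents cs hst hs ht
  refine ⟨h0, ?_⟩
  have hlen : ∀ i j, i + j = M s t → cs.length v + j ≤ cs.length (v * P cs s t j) ∧
      cs.length v + j ≤ cs.length (v * P cs t s j) := by
    intro i
    induction i with
    | zero =>
      intro j hj
      rw [show j = M s t by omega, ← P_longest, ← hw, hl]; simp
    | succ i ih =>
      intro j hj
      have := ih (j+1) (by omega)
      rw [P_succ, P_succ, ← mul_assoc, ← mul_assoc] at this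
      have h1 := cs.length_mul_le (v * P cs s t j) (cs.simple s)
      have h2 := cs.length_mul_le (v * P cs t s j) (cs.simple t)
      rw [cs.length_simple] at h1 h2
      omega
  intro u hu
  obtain ⟨j, hj, hj'⟩ := coset_form cs h0 hw hu
  have hle : cs.length v + j ≤ cs.length u := by
    have := hlen (M s t - j) j (by omega)
    rcases hj' with rfl | rfl <;> omega
  have hge : cs.length u ≤ cs.length v + j := by
    rcases hj' with rfl | rfl
    · have := cs.length_mul_le v (P cs s t j)
      have := length_P_le cs s t j
      omega
    · have := cs.length_mul_le v (P cs t s j)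
      have := length_P_le cs t s j
      omega
  refine ⟨by omega, fun hne => ?_⟩
  have hjm : j < M s t := by
    rcases hj.lt_or_eq with h | h
    · exact h
    · exfalso; apply hne
      rcases hj' with rfl | rfl
      · rw [h, hw]
      · rw [h, hw, P_longest]
  refine ⟨by omega, ?_⟩
  rw [cs.isRightDescent_iff, cs.isRightDescent_iff]
  have := hlen (M s t - (j+1)) (j+1) (by omega)
  rw [P_succ, P_succ, ← mul_assoc, ← mul_assoc] at this
  rcases hj' with rfl | rfl <;> omega

theorem exists_top (u : W) {s t : S} (h0 : M s t ≠ 0) :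
    ∃ w, cs.IsRightDescent w s ∧ cs.IsRightDescent w t ∧ u ∈ Kc cs w s t := by
  by_contra hcon
  have key : ∀ n, ∃ a b, ((a = s ∧ b = t) ∨ (a = t ∧ b = s)) ∧ u * P cs a b n ∈ Kc cs u s t ∧
      cs.length (u * P cs a b n) = cs.length u + n := by
    intro n
    induction n with
    | zero => exact ⟨s, t, Or.inl ⟨rfl, rfl⟩, by simp [P_zero, Kc_self], by simp [P_zero]⟩
    | succ n ih =>
      obtain ⟨a, b, hab, hK, hl⟩ := ih
      have hnot : ¬ (cs.IsRightDescent (u * P cs a b n) a ∧ cs.IsRightDescent (u * P cs a b n) b) := by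
        rintro ⟨h1, h2⟩
        apply hcon
        refine ⟨_, ?_, ?_, Kc_symm cs hK⟩
        · rcases hab with ⟨rfl, rfl⟩ | ⟨rfl, rfl⟩ <;> assumption
        · rcases hab with ⟨rfl, rfl⟩ | ⟨rfl, rfl⟩ <;> assumption
      have fin : ∀ a b, ((a = s ∧ b = t) ∨ (a = t ∧ b = s)) → u * P cs a b n ∈ Kc cs u s t → 
          cs.length (u * P cs a b n) = cs.length u + n →
          ¬ cs.IsRightDescent (u * P cs a b n) a → 
          ∃ a b, ((a = s ∧ b = t) ∨ (a = t ∧ b = s)) ∧ u * P cs a b (n+1) ∈ Kc cs u s t ∧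
      cs.length (u * P cs a b (n+1)) = cs.length u + (n+1) := by
        intro a b hab hK hl h
        refine ⟨b, a, by tauto, ?_, ?_⟩
        · rw [P_succ, ← mul_assoc]
          rcases hab with ⟨rfl, rfl⟩ | ⟨rfl, rfl⟩
          · exact Kc_mul_left cs hK
          · exact Kc_mul_right cs hK
        · rw [P_succ, ← mul_assoc]
          rw [cs.not_isRightDescent_iff] at h
          omega
      by_cases ha : cs.IsRightDescent (u * P cs a b n) a
      · have hb : ¬ cs.IsRightDescent (u * P cs a b n) b := fun h => hnot ⟨ha, h⟩
        rcases n with _ | n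
        · have e : P cs a b 0 = P cs b a 0 := by rw [P_zero, P_zero]
          rw [e] at hb hK hl
          exact fin b a (by tauto) hK hl hb
        · exfalso; apply hb
          rw [cs.isRightDescent_iff, mul_assoc, P_mul]
          have := cs.length_mul_le u (P cs b a n)
          have := length_P_le cs b a n
          have := cs.length_mul_simple (u * P cs a b (n+1)) b
          rw [mul_assoc, P_mul] at this
          omega
      · exact fin a b hab hK hl ha
  obtain ⟨a, b, hab, -, hl⟩ := key (M s t + 1)
  have hm : M a b = M s t := by
    rcases hab with ⟨rfl, rfl⟩ | ⟨rfl, rfl⟩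
    · rfl
    · exact M.symmetric _ _
  have := P_reduced cs (s := a) (t := b) (j := M s t + 1) (by rw [hm]; exact h0) (by
    have := cs.length_mul_le u (P cs a b (M s t + 1))
    omega)
  omega

lemma kk_nonneg {s t : S} (hst : s ≠ t) : 0 ≤ kk M s t := by
  have := ee_nonneg (M := M) hst (j := 2) (fun h => by have := M.off_diagonal s t hst; omega)
  simpa [ee] using this

lemma rho_ge (x : S → ℝ) (hx : ∀ i, fs M i x ≤ 0) (w : W) : x ≤ rho cs w x := by
  induction hn : cs.length w using Nat.strong_induction_on generalizing w with
  | _ n ih =>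
    by_cases hw : w = 1
    · subst hw; simp
    · obtain ⟨t, ht⟩ := cs.exists_rightDescent_of_ne_one hw
      have h1 := rho_nonneg cs _ t (cs.isRightDescent_iff_not_isRightDescent_mul.mp ht)
      have e : w = (w * cs.simple t) * cs.simple t := by simp
      rw [e, rho_mul_simple]
      have h2 := ih _ (by rw [← hn]; exact ht) (w * cs.simple t) rfl
      have h3 := smul_nonneg (neg_nonneg.mpr (hx t)) h1
      calc x ≤ _ := h2
        _ ≤ rho cs (w * cs.simple t) x + (-fs M t x) • rho cs (w * cs.simple t) (al t) :=
          le_add_of_nonneg_right h3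
        _ = _ := by rw [neg_smul, sub_eq_add_neg]

theorem no_three {w : W} {s t r : S} (hst : s ≠ t) (htr : t ≠ r) (hsr : s ≠ r)
    (h2 : (M s t : ℝ)⁻¹ + (M t r : ℝ)⁻¹ + (M s r : ℝ)⁻¹ ≤ 1)
    (hs : cs.IsRightDescent w s) (ht : cs.IsRightDescent w t) (hr : cs.IsRightDescent w r) :
    False := by
  have bnd : ∀ a b : S, a ≠ b → 0 ≤ (M a b : ℝ)⁻¹ ∧ (M a b : ℝ)⁻¹ ≤ 1/2 := by
    intro a b hab
    refine ⟨by positivity, ?_⟩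
    have := M.off_diagonal a b hab
    by_cases h0 : M a b = 0
    · rw [h0]; norm_num
    · have : (2:ℝ) ≤ M a b := by
        have : 2 ≤ M a b := by omega
        exact_mod_cast this
      rw [inv_le_comm₀ (by linarith) (by norm_num)]; linarith
  obtain ⟨p0, p1⟩ := bnd s t hst
  obtain ⟨q0, q1⟩ := bnd t r htr
  obtain ⟨r0, r1⟩ := bnd s r hsr
  set dl := (1 - ((M s t : ℝ)⁻¹ + (M t r : ℝ)⁻¹ + (M s r : ℝ)⁻¹)) / 3 with hdl
  have hdl0 : 0 ≤ dl := by rw [hdl]; linarith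
  set A := (M t r : ℝ)⁻¹ + dl with hA
  set B := (M s r : ℝ)⁻¹ + dl with hB
  set C := (M s t : ℝ)⁻¹ + dl with hC
  have hsum : A + B + C = 1 := by rw [hA, hB, hC, hdl]; ring
  have hA1 : A < 1 := by linarith
  have hB1 : B < 1 := by linarith
  have hC1 : C < 1 := by linarith
  have sn : ∀ A : ℝ, 0 ≤ A → A ≤ 1 → 0 ≤ sin (π * A) := fun A h h' =>
    sin_nonneg_of_nonneg_of_le_pi (by positivity) (by nlinarith [pi_pos])
  have sA := sn A (by linarith) (by linarith)
  have sB := sn B (by linarith) (by linarith)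
  have sC := sn C (by linarith) (by linarith)
  have hk : ∀ (a b : S) (C : ℝ), (M a b : ℝ)⁻¹ ≤ C → C ≤ 1 → 2 * cos (π * C) ≤ kk M a b := by
    intro a b C h h'
    rw [kk, div_eq_mul_inv]
    have : cos (π * C) ≤ cos (π * (M a b : ℝ)⁻¹) := by
      apply cos_le_cos_of_nonneg_of_le_pi
      · positivity
      · nlinarith [pi_pos]
      · nlinarith [pi_pos]
    linarith
  have kC := hk s t C (by linarith) (by linarith)
  have kA := hk t r A (by linarith) (by linarith)
  have kB := hk s r B (by linarith) (by linarith)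
  have tri : ∀ A B C : ℝ, A + B + C = 1 → sin (π * A) = sin (π * B) * cos (π * C) + sin (π * C) * cos (π * B) := by
    intro A B C h
    rw [show π * A = π - (π * B + π * C) by linear_combination π * h, sin_pi_sub, sin_add]; ring
  set x : S → ℝ := sin (π * A) • al s + sin (π * B) • al t + sin (π * C) • al r with hx
  have hf : ∀ i, fs M i x = -(sin (π * A) * kk M i s + sin (π * B) * kk M i t + sin (π * C) * kk M i r) := by
    intro i
    rw [hx]; simp only [map_add, map_smul, fs_al, smul_eq_mul]; ring
  have hfi : ∀ i, fs M i x ≤ 0 := by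
    intro i
    rw [hf]
    by_cases his : i = s
    · subst his
      rw [kk_self]
      have := tri A B C hsum
      nlinarith
    by_cases hit : i = t
    · subst hit
      rw [kk_self, kk_symm M i s]
      have := tri B A C (by linarith)
      nlinarith
    by_cases hir : i = r
    · subst hir
      rw [kk_self, kk_symm M i s, kk_symm M i t]
      have := tri C A B (by linarith)
      nlinarith
    have := mul_nonneg sA (kk_nonneg (M := M) his)
    have := mul_nonneg sB (kk_nonneg (M := M) hit)
    have := mul_nonneg sC (kk_nonneg (M := M) hir)
    linarith
  have h1 := rho_ge cs x hfi w
  have h3 : rho cs w x ≤ 0 := by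
    rw [hx]; simp only [map_add, map_smul]
    have e : ∀ a : S, ∀ c : ℝ, 0 ≤ c → cs.IsRightDescent w a → c • rho cs w (al a) ≤ 0 :=
      fun a c hc h => smul_nonpos_of_nonneg_of_nonpos hc (rho_nonpos cs w a h)
    exact add_nonpos (add_nonpos (e s _ sA hs) (e t _ sB ht)) (e r _ sC hr)
  have h4 : x ≤ 0 := h1.trans h3
  have v1 := h4 s
  have v2 := h4 t
  have v3 := h4 r
  simp only [hx, al, Pi.add_apply, Pi.smul_apply, Pi.single_apply, hst, htr, hsr, hst.symm, htr.symm,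
    hsr.symm, if_true, if_false, smul_eq_mul, mul_one, mul_zero, add_zero, zero_add, Pi.zero_apply] at v1 v2 v3
  have z : ∀ A : ℝ, 0 ≤ A → A < 1 → sin (π * A) ≤ 0 → A = 0 := by
    intro A h0 h1 h
    by_contra hne
    have : 0 < sin (π * A) := sin_pos_of_pos_of_lt_pi (by positivity) (by nlinarith [pi_pos])
    linarith
  have := z A (by linarith) hA1 v1
  have := z B (by linarith) hB1 v2
  have := z C (by linarith) hC1 v3
  linarith

end Cox


/-- Alternating product `a^x1 b^x2 a^x3 ...`. -/
def altP {G : Type*} [Group G] (a b : G) : List ℤ → G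
  | [] => 1
  | x :: xs => a ^ x * altP b a xs

lemma map_altP {G H : Type*} [Group G] [Group H] (φ : G →* H) (a b : G) (xs : List ℤ) :
    φ (altP a b xs) = altP (φ a) (φ b) xs := by
  induction xs generalizing a b with
  | nil => simp [altP]
  | cons x xs ih => simp [altP, ih]

lemma map_altWord {G H : Type*} [Group G] [Group H] (φ : G →* H) (a b : G) (n : ℕ) :
    φ (altWord a b n) = altWord (φ a) (φ b) n := by
  induction n generalizing a b with
  | zero => simp [altWord]
  | succ x ih => simp [altWord, ih]

namespace Dih
variable (m : ℕ)

/-- nonzero residues -/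
abbrev NZ := {e : ZMod m // e ≠ 0}

/-- The set on which `Z/2 * Z/m` acts. -/
abbrev X := ZMod m × List (NZ m)

def tauF (p : X m) : X m :=
  if h : p.1 ≠ 0 then (0, ⟨p.1, h⟩ :: p.2) else
    match p.2 with
    | [] => (0, [])
    | e :: l => (e.1, l)

lemma tauF_ne {k : ZMod m} (h : k ≠ 0) (l : List (NZ m)) : tauF m (k, l) = (0, ⟨k, h⟩ :: l) := by
  simp [tauF, h]
lemma tauF_nil : tauF m (0, []) = (0, []) := by simp [tauF]
lemma tauF_cons (e : NZ m) (l : List (NZ m)) : tauF m (0, e :: l) = (e.1, l) := by simp [tauF]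

lemma tauF_tauF (p : X m) : tauF m (tauF m p) = p := by
  obtain ⟨k, l⟩ := p
  by_cases h : k = 0
  · subst h
    cases l with
    | nil => rw [tauF_nil, tauF_nil]
    | cons e l => rw [tauF_cons, tauF_ne m e.2]
  · rw [tauF_ne m h, tauF_cons]

def tau : Equiv.Perm (X m) := ⟨tauF m, tauF m, tauF_tauF m, tauF_tauF m⟩
def zed : Equiv.Perm (X m) := ⟨fun p => (p.1 + 1, p.2), fun p => (p.1 - 1, p.2),
  fun p => by simp, fun p => by simp⟩

lemma tau_tau : tau m * tau m = 1 := by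
  ext1 p; exact tauF_tauF m p

lemma zed_pow (n : ℕ) (p : X m) : (zed m ^ n) p = (p.1 + n, p.2) := by
  induction n with
  | zero => simp
  | succ n ih => rw [pow_succ', Equiv.Perm.mul_apply, ih]; simp [zed, add_assoc]

lemma zed_pow_m : zed m ^ m = 1 := by
  ext1 p; rw [zed_pow]; simp

def sS : Equiv.Perm (X m) := zed m * tau m
def tT : Equiv.Perm (X m) := tau m * zed m

lemma tT_eq : tT m = tau m * sS m * (tau m)⁻¹ := by
  rw [sS, tT]; group

lemma tau_inv : (tau m)⁻¹ = tau m := by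
  rw [inv_eq_iff_mul_eq_one]; exact tau_tau m

lemma alt_sS (n : ℕ) : altWord (sS m) (tT m) n = zed m ^ n * tau m ^ n ∧
    altWord (tT m) (sS m) n = tau m * zed m ^ n * tau m ^ (n+1) := by
  have h2 := tau_tau m
  induction n with
  | zero => simp [altWord, tau_tau]
  | succ n ih =>
    rw [altWord, altWord, ih.1, ih.2]
    constructor
    · rw [sS]
      calc _ = zed m * (tau m * tau m) * zed m ^ n * tau m ^ (n+1) := by group
        _ = _ := by rw [h2, pow_succ' (zed m)]; group
    · rw [tT, pow_succ' (tau m) (n+1), pow_succ' (tau m) n]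
      calc _ = tau m * zed m ^ (n+1) * tau m ^ n := by group
        _ = tau m * zed m ^ (n+1) * (tau m * tau m) * tau m ^ n := by rw [h2]; group
        _ = _ := by group

lemma braid_sS : altWord (sS m) (tT m) m = altWord (tT m) (sS m) m := by
  rw [(alt_sS m m).1, (alt_sS m m).2, zed_pow_m, pow_succ']
  simp only [one_mul, mul_one, ← mul_assoc, tau_tau]

/-- The state reached. -/
noncomputable def F : List ℤ → X m
  | [] => (0, [])
  | x :: xs => (sS m ^ x) (tau m (F xs))

lemma altP_base (xs : List ℤ) : altP (sS m) (tT m) xs (0, []) = F m xs ∧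
    altP (tT m) (sS m) xs (0, []) = tau m (F m xs) := by
  induction xs with
  | nil => exact ⟨rfl, (tauF_nil m).symm⟩
  | cons x xs ih =>
    simp only [altP, F, Equiv.Perm.mul_apply, ih]
    refine ⟨trivial, ?_⟩
    rw [tT_eq, ← MulAut.conj_apply, ← map_zpow, MulAut.conj_apply, tau_inv]
    rfl

/-- number of positive entries -/
def Np (xs : List ℤ) : ℕ := xs.countP (fun x => 0 < x)
def Nn (xs : List ℤ) : ℕ := xs.countP (fun x => x < 0)

lemma Np_add_Nn_le (xs : List ℤ) : Np xs + Nn xs ≤ xs.length := by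
  induction xs with
  | nil => simp [Np, Nn]
  | cons x xs ih =>
    unfold Np Nn at *
    rw [List.countP_cons, List.countP_cons, List.length_cons]
    rcases lt_trichotomy x 0 with h | h | h
    · have : ¬ (0 < x) := by omega
      simp [h, this]; omega
    · subst h; simp; omega
    · have : ¬ (x < 0) := by omega
      simp [h, this]; omega

lemma cast_ne {e : ℤ} (h0 : e ≠ 0) (h : |e| < m) : (e : ZMod m) ≠ 0 := by
  rw [Ne, ZMod.intCast_zmod_eq_zero_iff_dvd]
  intro hd
  exact h0 (Int.eq_zero_of_abs_lt_dvd hd h)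

/-- underlying list -/
def vl (p : X m) : List (ZMod m) := p.2.map Subtype.val

lemma tau_zero {p : X m} (h : p.1 = 0) {c : ZMod m} {cs : List (ZMod m)} (hv : vl m p = c :: cs) :
    (tau m p).1 = c ∧ vl m (tau m p) = cs := by
  obtain ⟨k, l⟩ := p
  simp only at h
  subst h
  rcases l with _ | ⟨e, l⟩
  · simp [vl] at hv
  · simp only [vl, List.map_cons, List.cons.injEq] at hv
    have : tau m (0, e :: l) = (e.1, l) := tauF_cons m e l
    rw [this]; exact hv

lemma tau_ne {p : X m} (h : p.1 ≠ 0) :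
    (tau m p).1 = 0 ∧ vl m (tau m p) = p.1 :: vl m p := by
  have : tau m p = (0, ⟨p.1, h⟩ :: p.2) := tauF_ne m h p.2
  rw [this]; simp [vl]

lemma zed_fst (p : X m) : (zed m p).1 = p.1 + 1 := rfl
lemma zed_vl (p : X m) : vl m (zed m p) = vl m p := rfl
lemma zedi_fst (p : X m) : ((zed m)⁻¹ p).1 = p.1 - 1 := rfl
lemma zedi_vl (p : X m) : vl m ((zed m)⁻¹ p) = vl m p := rfl

/-- cast list -/
def cl (es : List ℤ) : List (ZMod m) := es.map (fun x : ℤ => (x : ZMod m))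

/-- description of positive and negative states -/
def DP (e : ℤ) (es : List ℤ) (p : X m) : Prop := p.1 = e ∧ vl m p = cl m es
def DN (e : ℤ) (es : List ℤ) (p : X m) : Prop := p.1 = 0 ∧ vl m p = cl m (e :: es)

lemma DN_tau {e : ℤ} {es : List ℤ} {p : X m} (h : DN m e es p) : DP m e es (tau m p) := by
  exact tau_zero m h.1 (by rw [h.2]; rfl)

lemma DP_tau {e : ℤ} {es : List ℤ} {p : X m} (he : (e : ZMod m) ≠ 0) (h : DP m e es p) :
    DN m e es (tau m p) := by
  have := tau_ne m (p := p) (by rw [h.1]; exact he)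
  refine ⟨this.1, ?_⟩
  rw [this.2, h.1, h.2]; rfl

lemma pow_pos' (Pd : ℤ → Prop) (hP : ∀ y, Pd y → (y : ZMod m) ≠ 0) (h1 : Pd 1) (k : ℕ) (p : X m)
    (e : ℤ) (es : List ℤ) (he0 : 0 < e) (he : Pd e) (hes : ∀ y ∈ es, Pd y) (h : DP m e es p) :
    ∃ e' es', 0 < e' ∧ Pd e' ∧ (∀ y ∈ es', Pd y) ∧ DP m e' es' ((sS m ^ k) p) ∧
      e' + es'.sum = e + es.sum + k := by
  induction k with
  | zero => exact ⟨e, es, he0, he, hes, h, by simp⟩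
  | succ k ih =>
    obtain ⟨e', es', a1, a2, a3, a4, a5⟩ := ih
    refine ⟨1, e' :: es', by norm_num, h1, ?_, ?_, ?_⟩
    · intro y hy
      rcases List.mem_cons.mp hy with rfl | hy
      · exact a2
      · exact a3 y hy
    · rw [pow_succ', Equiv.Perm.mul_apply]
      have := DP_tau m (hP _ a2) a4
      refine ⟨?_, ?_⟩
      · show (zed m (tau m _)).1 = _
        rw [zed_fst, this.1]; simp
      · show vl m (zed m (tau m _)) = _
        rw [zed_vl, this.2]
    · rw [List.sum_cons]; push_cast; linarith

lemma pow_neg' (Pd : ℤ → Prop) (hP : ∀ y, Pd y → (y : ZMod m) ≠ 0) (h1 : Pd (-1)) (k : ℕ) (p : X m)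
    (e : ℤ) (es : List ℤ) (he0 : e < 0) (he : Pd e) (hes : ∀ y ∈ es, Pd y) (h : DN m e es p) :
    ∃ e' es', e' < 0 ∧ Pd e' ∧ (∀ y ∈ es', Pd y) ∧ DN m e' es' (((sS m)⁻¹ ^ k) p) ∧
      e' + es'.sum = e + es.sum - k := by
  induction k with
  | zero => exact ⟨e, es, he0, he, hes, h, by simp⟩
  | succ k ih =>
    obtain ⟨e', es', a1, a2, a3, a4, a5⟩ := ih
    refine ⟨-1, e' :: es', by norm_num, h1, ?_, ?_, ?_⟩
    · intro y hy
      rcases List.mem_cons.mp hy with rfl | hy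
      · exact a2
      · exact a3 y hy
    · rw [pow_succ', Equiv.Perm.mul_apply]
      have e1 : (sS m)⁻¹ = tau m * (zed m)⁻¹ := by rw [sS, mul_inv_rev, tau_inv]
      rw [e1, Equiv.Perm.mul_apply, ← e1]
      apply DP_tau m (hP _ h1)
      exact ⟨by rw [zedi_fst, a4.1]; simp, by rw [zedi_vl, a4.2]⟩
    · rw [List.sum_cons]; push_cast; linarith

theorem F_desc (hm : 2 ≤ m) (xs : List ℤ) (h0 : ∀ x ∈ xs, x ≠ 0) (hp : Np xs < m) (hn : Nn xs < m) :
    (xs = [] ∧ F m xs = (0, [])) ∨ ∃ (e : ℤ) (es : List ℤ), xs ≠ [] ∧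
      (∀ y ∈ e :: es, (0 < y ∧ y ≤ Np xs) ∨ (y < 0 ∧ -y ≤ Nn xs)) ∧ e + es.sum = xs.sum ∧
      ((0 < e ∧ DP m e es (F m xs)) ∨ (e < 0 ∧ DN m e es (F m xs))) := by
  induction xs with
  | nil => exact Or.inl ⟨rfl, rfl⟩
  | cons x xs ih =>
    right
    have hx : x ≠ 0 := h0 x (by simp)
    have hNp : Np (x :: xs) = Np xs + (if 0 < x then 1 else 0) := by
      simp [Np, List.countP_cons]
    have hNn : Nn (x :: xs) = Nn xs + (if x < 0 then 1 else 0) := by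
      simp [Nn, List.countP_cons]
    have ih := ih (fun y hy => h0 y (by simp [hy])) (by omega) (by omega)
    set Pd : ℤ → Prop := fun y => (0 < y ∧ y ≤ Np (x :: xs)) ∨ (y < 0 ∧ -y ≤ Nn (x :: xs)) with hPd
    have hP : ∀ y, Pd y → (y : ZMod m) ≠ 0 := by
      intro y hy
      apply cast_ne
      · rcases hy with hy | hy <;> omega
      · rw [abs_lt]
        rcases hy with hy | hy <;> omega
    have hmono : ∀ y : ℤ, ((0 < y ∧ y ≤ Np xs) ∨ (y < 0 ∧ -y ≤ Nn xs)) → Pd y := by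
      intro y hy
      simp only [hPd, hNp, hNn]
      push_cast
      rcases hy with hy | hy
      · left; refine ⟨hy.1, ?_⟩; split_ifs <;> omega
      · right; refine ⟨hy.1, ?_⟩; split_ifs <;> omega
    rcases lt_or_gt_of_ne hx with hneg | hpos
    · -- negative
      have hP1 : Pd (-1) := by
        right; rw [hNn]; simp [hneg]
      have key : ∃ e es, e < 0 ∧ Pd e ∧ (∀ y ∈ es, Pd y) ∧ e + es.sum = xs.sum - 1 ∧
          DN m e es ((sS m)⁻¹ (tau m (F m xs))) := by
        have e1 : (sS m)⁻¹ = tau m * (zed m)⁻¹ := by rw [sS, mul_inv_rev, tau_inv]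
        rw [e1, Equiv.Perm.mul_apply]
        rcases ih with ⟨rfl, hF⟩ | ⟨e, es, hne, hall, hsum, ⟨he, hd⟩ | ⟨he, hd⟩⟩
        · refine ⟨-1, [], by norm_num, hP1, by simp, by simp, ?_⟩
          apply DP_tau m (hP _ hP1)
          have : tau m (F m []) = (0, []) := tauF_nil m
          rw [this]
          exact ⟨by rw [zedi_fst]; simp, rfl⟩
        · refine ⟨-1, e :: es, by norm_num, hP1, fun y hy => hmono _ (hall y hy),
            by rw [List.sum_cons]; linarith, ?_⟩
          apply DP_tau m (hP _ hP1)
          have := DP_tau m (hP _ (hmono _ (hall e (by simp)))) hd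
          exact ⟨by rw [zedi_fst, this.1]; simp, by rw [zedi_vl, this.2]⟩
        · have hPe : Pd (e - 1) := by
            right
            have := hall e (by simp)
            rw [hNn]; simp only [hneg, if_true]; push_cast; omega
          refine ⟨e - 1, es, by omega, hPe, fun y hy => hmono _ (hall y (by simp [hy])),
            by linarith, ?_⟩
          apply DP_tau m (hP _ hPe)
          have := DN_tau m hd
          exact ⟨by rw [zedi_fst, this.1]; push_cast; rfl, by rw [zedi_vl, this.2]⟩
      obtain ⟨e, es, k1, k2, k3, k4, k5⟩ := key
      obtain ⟨k, hk⟩ : ∃ k : ℕ, x = -(k + 1) := ⟨(-x - 1).toNat, by omega⟩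
      obtain ⟨e', es', b1, b2, b3, b4, b5⟩ := pow_neg' m Pd hP hP1 k _ e es k1 k2 k3 k5
      refine ⟨e', es', by simp, ?_, by rw [List.sum_cons]; linarith, Or.inr ⟨b1, ?_⟩⟩
      · intro y hy
        rcases List.mem_cons.mp hy with rfl | hy
        · exact b2
        · exact b3 y hy
      · have : F m (x :: xs) = ((sS m)⁻¹ ^ k) ((sS m)⁻¹ (tau m (F m xs))) := by
          rw [F, ← Equiv.Perm.mul_apply ((sS m)⁻¹ ^ k), ← pow_succ, hk, zpow_neg, inv_pow]
          norm_cast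
        rw [this]; exact b4
    · have hP1 : Pd 1 := by
        left; rw [hNp]; simp [hpos]
      have key : ∃ e es, 0 < e ∧ Pd e ∧ (∀ y ∈ es, Pd y) ∧ e + es.sum = xs.sum + 1 ∧
          DP m e es (sS m (tau m (F m xs))) := by
        have e1 : sS m (tau m (F m xs)) = zed m (F m xs) := by
          show zed m (tauF m (tauF m (F m xs))) = _
          rw [tauF_tauF]
        rw [e1]
        rcases ih with ⟨rfl, hF⟩ | ⟨e, es, hne, hall, hsum, ⟨he, hd⟩ | ⟨he, hd⟩⟩
        · refine ⟨1, [], by norm_num, hP1, by simp, by simp, ?_⟩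
          rw [hF]
          exact ⟨by rw [zed_fst]; simp, rfl⟩
        · have hPe : Pd (e + 1) := by
            left
            have := hall e (by simp)
            rw [hNp]; simp only [hpos, if_true]; push_cast; omega
          refine ⟨e + 1, es, by omega, hPe, fun y hy => hmono _ (hall y (by simp [hy])),
            by linarith, ?_⟩
          exact ⟨by rw [zed_fst, hd.1]; push_cast; rfl, by rw [zed_vl, hd.2]⟩
        · refine ⟨1, e :: es, by norm_num, hP1, fun y hy => hmono _ (hall y hy),
            by rw [List.sum_cons]; linarith, ?_⟩
          exact ⟨by rw [zed_fst, hd.1]; simp, by rw [zed_vl, hd.2]⟩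
      obtain ⟨e, es, k1, k2, k3, k4, k5⟩ := key
      obtain ⟨k, hk⟩ : ∃ k : ℕ, x = (k + 1) := ⟨(x - 1).toNat, by omega⟩
      obtain ⟨e', es', b1, b2, b3, b4, b5⟩ := pow_pos' m Pd hP hP1 k _ e es k1 k2 k3 k5
      refine ⟨e', es', by simp, ?_, by rw [List.sum_cons]; linarith, Or.inl ⟨b1, ?_⟩⟩
      · intro y hy
        rcases List.mem_cons.mp hy with rfl | hy
        · exact b2
        · exact b3 y hy
      · have : F m (x :: xs) = (sS m ^ k) (sS m (tau m (F m xs))) := by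
          rw [F, ← Equiv.Perm.mul_apply (sS m ^ k), ← pow_succ, hk]
          norm_cast
        rw [this]; exact b4

lemma num_aux (es es' : List ℤ) (h : cl m es = cl m es') (hs : es.sum < es'.sum) :
    ∃ y ∈ es, ∃ y' ∈ es', y < y' ∧ (y : ZMod m) = y' := by
  induction es generalizing es' with
  | nil =>
    rcases es' with _ | ⟨e', es'⟩
    · simp at hs
    · simp [cl] at h
  | cons e es ih =>
    rcases es' with _ | ⟨e', es'⟩
    · simp [cl] at h
    · simp only [cl, List.map_cons, List.cons.injEq] at h
      by_cases hlt : e < e'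
      · exact ⟨e, by simp, e', by simp, hlt, h.1⟩
      · rw [List.sum_cons, List.sum_cons] at hs
        obtain ⟨y, hy, y', hy', h1, h2⟩ := ih es' h.2 (by omega)
        exact ⟨y, by simp [hy], y', by simp [hy'], h1, h2⟩

lemma num_dvd {y y' : ℤ} (h : y < y') (hc : (y : ZMod m) = y') : y + m ≤ y' := by
  rw [ZMod.intCast_eq_intCast_iff_dvd_sub] at hc
  have := Int.le_of_dvd (by omega) hc
  omega

/-- Core girth statement in the permutation model with exponent sums. -/
theorem girth_core (hm : 2 ≤ m) (xs ys : List ℤ) (hx0 : ∀ x ∈ xs, x ≠ 0) (hy0 : ∀ x ∈ ys, x ≠ 0)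
    (hxp : Np xs < m) (hxn : Nn xs < m) (hyp : Np ys < m) (hyn : Nn ys < m)
    (hlen : xs.length + ys.length ≤ 2 * m - 1) (hsum : xs.sum = ys.sum)
    (h : F m xs = tau m (F m ys)) : xs = [] ∧ ys = [] := by
  have hbase : tau m ((0, []) : X m) = (0, []) := tauF_nil m
  have nz : ∀ {y : ℤ} {xs : List ℤ}, Np xs < m → Nn xs < m →
      ((0 < y ∧ y ≤ Np xs) ∨ (y < 0 ∧ -y ≤ Nn xs)) → (y : ZMod m) ≠ 0 := by
    intro y xs h1 h2 hy
    apply cast_ne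
    · rcases hy with hy | hy <;> omega
    · rw [abs_lt]
      rcases hy with hy | hy <;> omega
  have lx := Np_add_Nn_le xs
  have ly := Np_add_Nn_le ys
  have fin : ∀ (e e' : ℤ) (es es' xs ys : List ℤ), e < e' → e + es.sum = e' + es'.sum →
      (e : ZMod m) = e' → cl m es = cl m es' → Np xs < m → Nn xs < m → Np ys < m → Nn ys < m →
      (∀ y ∈ e :: es, (0 < y ∧ y ≤ Np xs) ∨ (y < 0 ∧ -y ≤ Nn xs)) → 
      (∀ y ∈ e' :: es', (0 < y ∧ y ≤ Np ys) ∨ (y < 0 ∧ -y ≤ Nn ys)) → 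
      Np xs + Nn xs + (Np ys + Nn ys) ≤ 2 * m - 1 → False := by
    intro e e' es es' xs ys h1 h2 h3 h4 a1 a2 a3 a4 h5 h6 h7
    obtain ⟨y', hy', y, hy, c1, c2⟩ := num_aux m es' es h4.symm (by omega)
    have d1 := num_dvd m h1 h3
    have d2 := num_dvd m c1 c2
    have p1 := h5 e (by simp)
    have p2 := h5 y (by simp [hy])
    have p3 := h6 e' (by simp)
    have p4 := h6 y' (by simp [hy'])
    omega
  rcases F_desc m hm xs hx0 hxp hxn with ⟨rfl, hF⟩ | ⟨e, es, hne, hall, hs, hd⟩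
  · rcases F_desc m hm ys hy0 hyp hyn with ⟨rfl, hF'⟩ | ⟨e', es', hne', hall', hs', hd'⟩
    · exact ⟨rfl, rfl⟩
    · exfalso
      have hz := nz hyp hyn (hall' e' (by simp))
      rw [hF] at h
      rcases hd' with ⟨_, hd'⟩ | ⟨_, hd'⟩
      · have := (DP_tau m hz hd').2
        rw [← h] at this; simp [vl, cl] at this
      · have := (DN_tau m hd').1
        rw [← h] at this; exact hz this.symm
  · exfalso
    have hz := nz hxp hxn (hall e (by simp))
    rcases F_desc m hm ys hy0 hyp hyn with ⟨rfl, hF'⟩ | ⟨e', es', hne', hall', hs', hd'⟩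
    · rw [hF', hbase] at h
      rcases hd with ⟨_, hd⟩ | ⟨_, hd⟩
      · have := hd.1
        rw [h] at this; exact hz this.symm
      · have := hd.2
        rw [h] at this; simp [vl, cl] at this
    · have hz' := nz hyp hyn (hall' e' (by simp))
      rcases hd with ⟨he, hd⟩ | ⟨he, hd⟩ <;> rcases hd' with ⟨he', hd'⟩ | ⟨he', hd'⟩
      · have := (DP_tau m hz' hd').1
        rw [← h, hd.1] at this; exact hz this
      · have := DN_tau m hd'
        rw [← h] at this
        exact fin e' e es' es ys xs (by omega) (by omega) (by rw [← this.1, hd.1])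
          (by rw [← this.2, hd.2]) hyp hyn hxp hxn hall' hall (by omega)
      · have := DP_tau m hz' hd'
        rw [← h] at this
        have e1 := hd.2.symm.trans this.2
        simp only [cl, List.map_cons, List.cons.injEq] at e1
        exact fin e e' es es' xs ys (by omega) (by omega) e1.1
          e1.2 hxp hxn hyp hyn hall hall' (by omega)
      · have := (DN_tau m hd').1
        rw [← h, hd.1] at this; exact hz' this.symm

end Dih


namespace Dih

lemma Np_Nn_of_mixed (xs : List ℤ) : (Np xs = xs.length ↔ ∀ x ∈ xs, 0 < x) ∧
    (Nn xs = xs.length ↔ ∀ x ∈ xs, x < 0) := by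
  constructor
  · rw [Np, List.countP_eq_length]; simp
  · rw [Nn, List.countP_eq_length]; simp

lemma Np_le (xs : List ℤ) : Np xs ≤ xs.length := List.countP_le_length
lemma Nn_le (xs : List ℤ) : Nn xs ≤ xs.length := List.countP_le_length

/-- The split girth property for a pair of elements of a group. -/
def Split (m : ℕ) {A : Type*} [Group A] (d d' : A) : Prop :=
  ∀ xs ys : List ℤ, (∀ x ∈ xs, x ≠ 0) → (∀ x ∈ ys, x ≠ 0) →
    Np xs < m → Nn xs < m → Np ys < m → Nn ys < m →
    xs.length + ys.length ≤ 2 * m - 1 → altP d d' xs = altP d' d ys → xs = [] ∧ ys = []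

/-- Girth property of the dihedral Artin group. -/
structure Good (m : ℕ) {A : Type*} [Group A] (d d' : A) : Prop where
  split : Split m d d'
  sum : ∀ xs ys : List ℤ, (altP d d' xs = altP d' d ys ∨ altP d d' xs = altP d d' ys) →
    xs.sum = ys.sum

lemma Split.symm {m : ℕ} {A : Type*} [Group A] {d d' : A} (h : Split m d d') : Split m d' d := by
  intro xs ys h1 h2 h3 h4 h5 h6 h7 h8
  exact (h ys xs h2 h1 h5 h6 h3 h4 (by omega) h8.symm).symm

lemma nonneg_sum {xs : List ℤ} (h : ∀ x ∈ xs, 0 < x) : 0 ≤ xs.sum :=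
  List.sum_nonneg (fun x hx => (h x hx).le)
lemma nonpos_sum {xs : List ℤ} (h : ∀ x ∈ xs, x < 0) : xs.sum ≤ 0 := by
  induction xs with
  | nil => simp
  | cons x xs ih =>
    rw [List.sum_cons]
    have h1 := h x (by simp)
    have h2 := ih (fun y hy => h y (by simp [hy]))
    omega

/-- Top lemma. -/
theorem Good.top {m : ℕ} (hm : 2 ≤ m) {A : Type*} [Group A] {d d' : A} (h : Good m d d')
    (xs ys : List ℤ) (hx : ∀ x ∈ xs, x ≠ 0) (hy : ∀ x ∈ ys, x ≠ 0) (lx : xs.length < m)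
    (ly : ys.length < m) (k : ℤ) (hk : k ≠ 0) : d ^ k * altP d' d xs ≠ altP d' d ys := by
  intro heq
  have e1 : altP d d' (k :: xs) = altP d' d ys := heq
  have e2 : altP d d' (-k :: ys) = altP d' d xs := by
    rw [altP, ← heq, ← mul_assoc, ← zpow_add]; simp
  have hs := h.sum _ _ (Or.inl e1)
  rw [List.sum_cons] at hs
  have nz : ∀ (k : ℤ) (xs : List ℤ), k ≠ 0 → (∀ x ∈ xs, x ≠ 0) → ∀ x ∈ k :: xs, x ≠ 0 := by
    intro k xs h1 h2 x hx
    rcases List.mem_cons.mp hx with rfl | hx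
    · exact h1
    · exact h2 x hx
  have a1 := Np_le xs
  have a2 := Nn_le xs
  have a3 := Np_le ys
  have a4 := Nn_le ys
  by_cases b1 : Np (k :: xs) < m ∧ Nn (k :: xs) < m
  · have := h.split (k :: xs) ys (nz k xs hk hx) hy b1.1 b1.2 (by omega) (by omega)
      (by rw [List.length_cons]; omega) e1
    simp at this
  by_cases b2 : Np (-k :: ys) < m ∧ Nn (-k :: ys) < m
  · have := h.split (-k :: ys) xs (nz (-k) ys (by omega) hy) hx b2.1 b2.2 (by omega) (by omega)
      (by rw [List.length_cons]; omega) e2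
    simp at this
  have bad : ∀ (k : ℤ) (xs : List ℤ), xs.length < m → ¬ (Np (k :: xs) < m ∧ Nn (k :: xs) < m) →
      (0 < k ∧ ∀ x ∈ xs, 0 < x) ∨ (k < 0 ∧ ∀ x ∈ xs, x < 0) := by
    intro k xs hl hb
    have c1 := Np_le (k :: xs)
    have c2 := Nn_le (k :: xs)
    have hl' : (k :: xs).length ≤ m := by rw [List.length_cons]; omega
    rw [not_and_or] at hb
    rcases hb with hb | hb
    · left
      have := (Np_Nn_of_mixed (k :: xs)).1.mp (by omega)
      exact ⟨this k (by simp), fun x hx => this x (by simp [hx])⟩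
    · right
      have := (Np_Nn_of_mixed (k :: xs)).2.mp (by omega)
      exact ⟨this k (by simp), fun x hx => this x (by simp [hx])⟩
  rcases bad k xs lx b1 with ⟨k1, p1⟩ | ⟨k1, p1⟩ <;> rcases bad (-k) ys ly b2 with ⟨k2, p2⟩ | ⟨k2, p2⟩
  · omega
  · have := nonneg_sum p1; have := nonpos_sum p2; omega
  · have := nonpos_sum p1; have := nonneg_sum p2; omega
  · omega

theorem Good.symm {m : ℕ} {A : Type*} [Group A] {d d' : A} (h : Good m d d')
    (hs : ∀ xs ys : List ℤ, altP d' d xs = altP d' d ys → xs.sum = ys.sum) : Good m d' d := by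
  refine ⟨h.split.symm, ?_⟩
  rintro xs ys (e | e)
  · exact (h.sum ys xs (Or.inl e.symm)).symm
  · exact hs xs ys e

theorem Good.compare_ne {m : ℕ} (hm : 2 ≤ m) {A : Type*} [Group A] {d d' : A} (h : Good m d d')
    (xs ys : List ℤ) (hx : ∀ x ∈ xs, x ≠ 0) (hy : ∀ x ∈ ys, x ≠ 0) (lx : xs.length < m)
    (ly : ys.length < m) (e : altP d d' xs = altP d' d ys) : xs = [] ∧ ys = [] := by
  have a1 := Np_le xs
  have a2 := Nn_le xs
  have a3 := Np_le ys
  have a4 := Nn_le ys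
  exact h.split xs ys hx hy (by omega) (by omega) (by omega) (by omega) (by omega) e

theorem Good.compare {m : ℕ} (hm : 2 ≤ m) {A : Type*} [Group A] {d d' : A} (h : Good m d d')
    (h' : Good m d' d)
    (xs ys : List ℤ) (hx : ∀ x ∈ xs, x ≠ 0) (hy : ∀ x ∈ ys, x ≠ 0) (lx : xs.length < m)
    (ly : ys.length < m) (e : altP d d' xs = altP d d' ys) : xs = ys := by
  induction xs generalizing ys d d' with
  | nil =>
    have := h.compare_ne hm [] ys
    exact (h'.compare_ne hm [] ys hx hy lx ly e).2.symm
  | cons x xs ih =>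
    rcases ys with _ | ⟨y, ys⟩
    · exact (h.compare_ne hm (x :: xs) [] hx hy lx ly e).1
    · rw [List.length_cons] at lx ly
      have hx' : ∀ x ∈ xs, x ≠ 0 := fun z hz => hx z (by simp [hz])
      have hy' : ∀ x ∈ ys, x ≠ 0 := fun z hz => hy z (by simp [hz])
      by_cases hxy : x = y
      · subst hxy
        simp only [altP, mul_right_inj] at e
        rw [ih h' h ys hx' hy' (by omega) (by omega) e]
      · exfalso
        apply h.top hm xs ys hx' hy' (by omega) (by omega) (x - y) (by omega)
        simp only [altP] at e
        rw [sub_eq_neg_add, zpow_add, mul_assoc, e, ← mul_assoc, ← zpow_add]; simp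

/-- The ambient group. -/
abbrev DD (m : ℕ) := Equiv.Perm (X m) × Multiplicative ℤ
/-- First generator. -/
abbrev gS (m : ℕ) : DD m := (sS m, Multiplicative.ofAdd 1)
/-- Second generator. -/
abbrev gT (m : ℕ) : DD m := (tT m, Multiplicative.ofAdd 1)

lemma hsnd (m : ℕ) (xs : List ℤ) : (altP (gS m) (gT m) xs).2 = Multiplicative.ofAdd xs.sum ∧
      (altP (gT m) (gS m) xs).2 = Multiplicative.ofAdd xs.sum := by
    induction xs with
    | nil => exact ⟨rfl, rfl⟩
    | cons x xs ih =>
      have a1 : (gS m ^ x).2 = Multiplicative.ofAdd x := by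
        rw [Prod.pow_snd, ← ofAdd_zsmul]; simp
      have a2 : (gT m ^ x).2 = Multiplicative.ofAdd x := by
        rw [Prod.pow_snd, ← ofAdd_zsmul]; simp
      simp only [altP, Prod.snd_mul, ih, a1, a2, List.sum_cons, ofAdd_add, and_self]

/-- Existence of the dihedral model. -/
theorem exists_good (m : ℕ) (hm : 2 ≤ m) : ∃ (A : Type) (_ : Group A) (_ : Countable A) (s t : A),
    altWord s t m = altWord t s m ∧ Good m s t ∧ Good m t s := by
  have hfst : ∀ (a b : DD m) (xs : List ℤ), (altP a b xs).1 = altP a.1 b.1 xs :=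
    fun a b xs => map_altP (MonoidHom.fst (Equiv.Perm (X m)) (Multiplicative ℤ)) a b xs
  have hsplit : Split m (gS m) (gT m) := by
    intro xs ys h1 h2 h3 h4 h5 h6 h7 h8
    apply girth_core m hm xs ys h1 h2 h3 h4 h5 h6 h7
    · have := congrArg Prod.snd h8
      rw [(hsnd m xs).1, (hsnd m ys).2] at this
      exact Multiplicative.ofAdd.injective this
    · have := congrArg Prod.fst h8
      rw [hfst, hfst] at this
      have := DFunLike.congr_fun this (0, [])
      rw [(altP_base m xs).1, (altP_base m ys).2] at this
      exact this
  let φ : FreeGroup Bool →* DD m := FreeGroup.lift (fun b => if b then gS m else gT m)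
  have hφs : φ (FreeGroup.of true) = gS m := by simp [φ]
  have hφt : φ (FreeGroup.of false) = gT m := by simp [φ]
  have hc : Countable (FreeGroup Bool) := by
    unfold FreeGroup; infer_instance
  have hcA : Countable φ.range := φ.rangeRestrict_surjective.countable
  have hv : ∀ (a b : φ.range) (xs : List ℤ), ((altP a b xs : φ.range) : DD m) = altP (a : DD m) (b : DD m) xs :=
    fun a b xs => map_altP φ.range.subtype a b xs
  have key : ∀ a b : φ.range, (a : DD m) = gS m → (b : DD m) = gT m → Good m a b := by
    intro a b ha hb
    constructor
    · intro xs ys h1 h2 h3 h4 h5 h6 h7 h8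
      apply hsplit xs ys h1 h2 h3 h4 h5 h6 h7
      have := congrArg Subtype.val h8
      rwa [hv, hv, ha, hb] at this
    · rintro xs ys (h | h)
      · have := congrArg Prod.snd (congrArg Subtype.val h)
        rw [hv, hv, ha, hb, (hsnd m xs).1, (hsnd m ys).2] at this
        exact Multiplicative.ofAdd.injective this
      · have := congrArg Prod.snd (congrArg Subtype.val h)
        rw [hv, hv, ha, hb, (hsnd m xs).1, (hsnd m ys).1] at this
        exact Multiplicative.ofAdd.injective this
  refine ⟨φ.range, inferInstance, hcA, ⟨gS m, ⟨_, hφs⟩⟩, ⟨gT m, ⟨_, hφt⟩⟩, ?_, key _ _ rfl rfl, ?_⟩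
  · apply Subtype.ext
    have e : ∀ (a b : φ.range) n, ((altWord a b n : φ.range) : DD m) = altWord (a : DD m) (b : DD m) n :=
      fun a b n => map_altWord φ.range.subtype a b n
    rw [e, e]
    apply Prod.ext
    · have := fun a b => map_altWord (MonoidHom.fst (Equiv.Perm (X m)) (Multiplicative ℤ)) a b m
      exact (this (gS m) (gT m)).trans ((braid_sS m).trans (this (gT m) (gS m)).symm)
    · have := fun a b => map_altWord (MonoidHom.snd (Equiv.Perm (X m)) (Multiplicative ℤ)) a b m
      exact (this (gS m) (gT m)).trans (this (gT m) (gS m)).symm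
  · apply (key _ _ rfl rfl).symm
    intro xs ys h
    have := congrArg Prod.snd (congrArg Subtype.val h)
    rw [hv, hv, (hsnd m xs).2, (hsnd m ys).2] at this
    exact Multiplicative.ofAdd.injective this
end Dih


namespace Ext

lemma bool_not : ∀ {d d' : Bool}, d' ≠ d → d' = !d := by decide

section R
variable {Z A : Type*} [Nonempty Z] [Group A] (σ : Bool → Equiv.Perm Z) (lev : Z → ℕ)
  (Ds : Z → Bool → Prop) (a : Bool → A)

/-- Chosen base point of an orbit. -/
noncomputable def base (d : Bool) (z : Z) : Z :=
  Classical.epsilon (fun b => (σ d).SameCycle z b ∧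
    ((∃ y, (σ d).SameCycle z y ∧ ¬ Ds y d) → ¬ Ds b d))

lemma base_spec (d : Bool) (z : Z) : (σ d).SameCycle z (base σ Ds d z) ∧
    ((∃ y, (σ d).SameCycle z y ∧ ¬ Ds y d) → ¬ Ds (base σ Ds d z) d) := by
  apply Classical.epsilon_spec (p := fun b => (σ d).SameCycle z b ∧
    ((∃ y, (σ d).SameCycle z y ∧ ¬ Ds y d) → ¬ Ds b d))
  by_cases h : ∃ y, (σ d).SameCycle z y ∧ ¬ Ds y d
  · obtain ⟨y, h1, h2⟩ := h
    exact ⟨y, h1, fun _ => h2⟩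
  · exact ⟨z, Equiv.Perm.SameCycle.refl _ _, fun h' => absurd h' h⟩

lemma base_zpow (d : Bool) (z : Z) (k : ℤ) : base σ Ds d ((σ d ^ k) z) = base σ Ds d z := by
  unfold base
  congr 1
  funext b
  simp only [Equiv.Perm.sameCycle_zpow_left]

lemma exists_kz (d : Bool) (z : Z) : ∃ k : ℤ, (σ d ^ k) (base σ Ds d z) = z :=
  (base_spec σ Ds d z).1.symm

/-- Exponent relative to the base point. -/
noncomputable def kz (d : Bool) (z : Z) : ℤ := (exists_kz σ Ds d z).choose

lemma kz_spec (d : Bool) (z : Z) : (σ d ^ (kz σ Ds d z)) (base σ Ds d z) = z :=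
  (exists_kz σ Ds d z).choose_spec

open Classical in
/-- The normal form map. -/
noncomputable def R (z : Z) : Z × A :=
  if h : ∃ d, Ds z d then
    if hl : lev (base σ Ds h.choose z) < lev z then
      ((R (base σ Ds h.choose z)).1, a h.choose ^ (kz σ Ds h.choose z) *
        (R (base σ Ds h.choose z)).2)
    else (base σ Ds h.choose z, a h.choose ^ (kz σ Ds h.choose z))
  else (z, 1)
termination_by lev z

/-- Hypotheses -/
structure Hyp (Z0 : Z → Prop) (m : ℕ) : Prop where
  orb : ∀ z d, Z0 z → Ds z d → ∀ k : ℤ, Z0 ((σ d ^ k) z) ∧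
    ((lev ((σ d ^ k) z) = lev z ∧ Ds ((σ d ^ k) z) d) ∨
     (lev ((σ d ^ k) z) + 1 = lev z ∧ ¬ Ds ((σ d ^ k) z) d))
  low : ∀ z d (k : ℤ), ¬ Ds z d → k ≠ 0 → Ds ((σ d ^ k) z) d
  free : ∀ z d (k : ℤ), k ≠ 0 → (σ d ^ k) z ≠ z
  uniq : ∀ z d d', Z0 z → Ds z d → Ds z d' → d = d'
  lt : ∀ z, Z0 z → lev z < m

variable {σ lev Ds} {Z0 : Z → Prop} {m : ℕ} (H : Hyp σ lev Ds Z0 m)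

/-- the base value -/
noncomputable def Rb (σ : Bool → Equiv.Perm Z) (lev : Z → ℕ)
  (Ds : Z → Bool → Prop) (a : Bool → A) (d : Bool) (b : Z) : Z × A := by
  classical exact if Ds b d then (b, 1) else R σ lev Ds a b

lemma R_high {z : Z} {d : Bool} (H : Hyp σ lev Ds Z0 m) (hz : Z0 z) (hd : Ds z d) :
    R σ lev Ds a z = ((Rb σ lev Ds a d (base σ Ds d z)).1, a d ^ (kz σ Ds d z) *
      (Rb σ lev Ds a d (base σ Ds d z)).2) := by
  rw [R]
  have h : ∃ d, Ds z d := ⟨d, hd⟩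
  have hc : h.choose = d := H.uniq z _ _ hz h.choose_spec hd
  rw [dif_pos h]
  simp only [hc]
  obtain ⟨k, hk⟩ := (base_spec σ Ds d z).1
  have := (H.orb z d hz hd k).2
  rw [hk] at this
  unfold Rb
  rcases this with ⟨h1, h2⟩ | ⟨h1, h2⟩
  · rw [dif_neg (by rw [h1]; exact lt_irrefl _), if_pos h2]; simp
  · rw [dif_pos (by rw [← h1]; exact Nat.lt_succ_self _), if_neg h2]

lemma kz_zpow (H : Hyp σ lev Ds Z0 m) (d : Bool) (z : Z) (k : ℤ) :
    kz σ Ds d ((σ d ^ k) z) = k + kz σ Ds d z := by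
  have h1 := kz_spec σ Ds d ((σ d ^ k) z)
  have h2 := kz_spec σ Ds d z
  rw [base_zpow] at h1
  set b := base σ Ds d z
  by_contra hne
  apply H.free b d (-(k + kz σ Ds d z) + kz σ Ds d ((σ d ^ k) z)) (by omega)
  rw [zpow_add, Equiv.Perm.mul_apply, h1, zpow_neg, Equiv.Perm.inv_eq_iff_eq, zpow_add, Equiv.Perm.mul_apply, h2]

lemma base_low (H : Hyp σ lev Ds Z0 m) {d : Bool} {z : Z} (hd : ¬ Ds z d) :
    base σ Ds d z = z := by
  have h := base_spec σ Ds d z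
  have h2 := h.2 ⟨z, Equiv.Perm.SameCycle.refl _ _, hd⟩
  obtain ⟨k, hk⟩ := h.1
  by_cases h0 : k = 0
  · subst h0; simpa using hk.symm
  · exact absurd (hk ▸ H.low z d k hd h0) h2

lemma kz_low (H : Hyp σ lev Ds Z0 m) {d : Bool} {z : Z} (hd : ¬ Ds z d) :
    kz σ Ds d z = 0 := by
  by_contra h0
  have := kz_spec σ Ds d z
  rw [base_low H hd] at this
  exact H.free z d _ h0 this

/-- property (ii) -/
lemma R_equiv (H : Hyp σ lev Ds Z0 m) {z : Z} {d : Bool} (hz : Z0 z) (hd : Ds z d) (k : ℤ) :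
    R σ lev Ds a ((σ d ^ k) z) = ((R σ lev Ds a z).1, a d ^ k * (R σ lev Ds a z).2) := by
  have gen : R σ lev Ds a ((σ d ^ k) z) = ((Rb σ lev Ds a d (base σ Ds d ((σ d ^ k) z))).1,
      a d ^ (kz σ Ds d ((σ d ^ k) z)) * (Rb σ lev Ds a d (base σ Ds d ((σ d ^ k) z))).2) := by
    rcases (H.orb z d hz hd k) with ⟨h0, ⟨_, h2⟩ | ⟨_, h2⟩⟩
    · exact R_high a H h0 h2
    · rw [base_low H h2, kz_low H h2, Rb, if_neg h2]; simp
  rw [gen, R_high a H hz hd, base_zpow, kz_zpow H, zpow_add]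
  simp [mul_assoc]

/-- property (i) -/
lemma R_form (H : Hyp σ lev Ds Z0 m) (hpos : ∀ z d, Z0 z → Ds z d → 1 ≤ lev z) (z : Z) (hz : Z0 z) :
    ∃ (d : Bool) (xs : List ℤ), (∀ x ∈ xs, x ≠ 0) ∧ xs.length ≤ lev z ∧
      z = altP (σ d) (σ !d) xs (R σ lev Ds a z).1 ∧
      (R σ lev Ds a z).2 = altP (a d) (a !d) xs ∧ (xs ≠ [] → Ds z d) := by
  induction hn : lev z using Nat.strong_induction_on generalizing z with
  | _ n ih =>
  subst hn
  by_cases hd : ∃ d, Ds z d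
  · obtain ⟨d, hd⟩ := hd
    have e := R_high a H hz hd
    obtain ⟨k, hk⟩ := (base_spec σ Ds d z).1
    have hb := (H.orb z d hz hd k)
    rw [hk] at hb
    have hkz := kz_spec σ Ds d z
    rcases hb with ⟨h0, ⟨h1, h2⟩ | ⟨h1, h2⟩⟩
    · rw [Rb, if_pos h2] at e
      rw [e]
      by_cases hk0 : kz σ Ds d z = 0
      · rw [hk0] at hkz ⊢
        refine ⟨d, [], by simp, by simp, by simpa [altP] using hkz.symm, by simp [altP], by simp⟩
      · refine ⟨d, [kz σ Ds d z], by simpa using hk0, hpos z d hz hd, ?_, ?_, fun _ => hd⟩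
        · simpa [altP] using hkz.symm
        · simp [altP]
    · rw [Rb, if_neg h2] at e
      rw [e]
      have hk0 : kz σ Ds d z ≠ 0 := by
        intro h
        rw [h] at hkz
        have : base σ Ds d z = z := hkz
        rw [this] at h2
        exact h2 hd
      obtain ⟨d1, xs, b1, b2, b3, b4, b5⟩ := ih _ (by omega) _ h0 rfl
      by_cases hx : xs = []
      · subst hx
        refine ⟨d, [kz σ Ds d z], by simpa using hk0, hpos z d hz hd, ?_, ?_, fun _ => hd⟩
        · simp only [altP, Equiv.Perm.coe_one, id_eq] at b3
          simp only [altP, mul_one]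
          rw [← b3]; exact hkz.symm
        · simp only [altP] at b4 ⊢
          rw [b4]
      · have hd1 : d1 = !d := by
          apply bool_not
          rintro rfl
          exact h2 (b5 hx)
        subst hd1
        rw [Bool.not_not] at b3 b4
        refine ⟨d, kz σ Ds d z :: xs, ?_, by rw [List.length_cons]; omega, ?_, ?_, fun _ => hd⟩
        · intro x hx
          rcases List.mem_cons.mp hx with rfl | hx
          · exact hk0
          · exact b1 x hx
        · simp only [altP, Equiv.Perm.mul_apply]
          rw [← b3]; exact hkz.symm
        · simp only [altP]
          rw [b4]
  · have : R σ lev Ds a z = (z, 1) := by rw [R, dif_neg hd]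
    rw [this]
    exact ⟨true, [], by simp, by simp, by simp [altP], by simp [altP], by simp⟩

/-- injectivity -/
lemma R_inj (H : Hyp σ lev Ds Z0 m) (hm : 2 ≤ m) (hpos : ∀ z d, Z0 z → Ds z d → 1 ≤ lev z)
    (hA : ∀ d, Dih.Good m (a d) (a !d)) {z z' : Z} (hz : Z0 z) (hz' : Z0 z')
    (e : R σ lev Ds a z = R σ lev Ds a z') : z = z' := by
  obtain ⟨d, xs, b1, b2, b3, b4, b5⟩ := R_form a H hpos z hz
  obtain ⟨d', xs', c1, c2, c3, c4, c5⟩ := R_form a H hpos z' hz'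
  have l1 := H.lt z hz
  have l2 := H.lt z' hz'
  rw [b3, c3, e]
  rw [e] at b4
  have b4 := b4.symm.trans c4
  by_cases h : d = d'
  · subst h
    have h2 := hA (!d)
    rw [Bool.not_not] at h2
    rw [Dih.Good.compare hm (hA d) h2 xs xs' b1 c1 (by omega) (by omega) b4]
  · have : d' = !d := bool_not (Ne.symm h)
    subst this
    rw [Bool.not_not] at b4
    obtain ⟨r1, r2⟩ := Dih.Good.compare_ne hm (hA d) xs xs' b1 c1 (by omega) (by omega) b4
    subst r1 r2
    simp [altP]

/-- low elements in the same coset -/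
lemma R_top (H : Hyp σ lev Ds Z0 m) (hm : 2 ≤ m) (hpos : ∀ z d, Z0 z → Ds z d → 1 ≤ lev z)
    (hA : ∀ d, Dih.Good m (a d) (a !d)) {z z' : Z} (hz : Z0 z) (hz' : Z0 z') (d : Bool)
    (hd : ¬ Ds z d) (hd' : ¬ Ds z' d) (k : ℤ) (hk : k ≠ 0) :
    a d ^ k * (R σ lev Ds a z).2 ≠ (R σ lev Ds a z').2 := by
  have key : ∀ z, Z0 z → ¬ Ds z d → ∃ xs : List ℤ, (∀ x ∈ xs, x ≠ 0) ∧ xs.length ≤ lev z ∧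
      (R σ lev Ds a z).2 = altP (a !d) (a d) xs := by
    intro z hz hd
    obtain ⟨d', xs, b1, b2, b3, b4, b5⟩ := R_form a H hpos z hz
    by_cases hx : xs = []
    · subst hx; exact ⟨[], b1, b2, b4⟩
    · have : d' = !d := by
        have h1 : d' ≠ d := by rintro rfl; exact hd (b5 hx)
        exact bool_not h1
      subst this
      rw [Bool.not_not] at b4
      exact ⟨xs, b1, b2, b4⟩
  obtain ⟨xs, b1, b2, b4⟩ := key z hz hd
  obtain ⟨xs', c1, c2, c4⟩ := key z' hz' hd'
  have l1 := H.lt z hz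
  have l2 := H.lt z' hz'
  rw [b4, c4]
  exact Dih.Good.top hm (hA d) xs xs' b1 c1 (by omega) (by omega) k hk

end R
end Ext


namespace Ext

section act
variable {S : Type*} [Fintype S] [DecidableEq S] {M : CoxeterMatrix S} {W : Type*} [Group W]
  (cs : CoxeterSystem M W)

/-- embedding of the two levels -/
def out (w : W) (s : S) : ℕ ⊕ ℕ → W × ℕ := Sum.elim (fun x => (w * cs.simple s, x)) (fun x => (w, x))

lemma desc_mul (w : W) (s : S) : cs.IsRightDescent (w * cs.simple s) s ↔ ¬ cs.IsRightDescent w s := by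
  rw [cs.isRightDescent_iff_not_isRightDescent_mul, mul_assoc, cs.simple_mul_simple_self, mul_one]

open Classical in
/-- block action -/
noncomputable def act (s : S) (p : W → Equiv.Perm (ℕ ⊕ ℕ)) (z : W × ℕ) : W × ℕ :=
  if cs.IsRightDescent z.1 s then out cs z.1 s (p z.1 (Sum.inr z.2))
  else out cs (z.1 * cs.simple s) s (p (z.1 * cs.simple s) (Sum.inl z.2))

lemma act_out (s : S) (p : W → Equiv.Perm (ℕ ⊕ ℕ)) (w : W) (hw : cs.IsRightDescent w s) (y : ℕ ⊕ ℕ) :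
    act cs s p (out cs w s y) = out cs w s (p w y) := by
  rcases y with x | x
  · have : ¬ cs.IsRightDescent (w * cs.simple s) s := by rw [desc_mul]; simpa using hw
    refine (if_neg this).trans ?_
    show out cs (w * cs.simple s * cs.simple s) s (p (w * cs.simple s * cs.simple s) (Sum.inl x)) = _
    rw [mul_assoc, cs.simple_mul_simple_self, mul_one]
  · exact if_pos hw

lemma exists_out (s : S) (z : W × ℕ) : ∃ w y, cs.IsRightDescent w s ∧ z = out cs w s y := by
  by_cases h : cs.IsRightDescent z.1 s
  · exact ⟨z.1, Sum.inr z.2, h, rfl⟩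
  · refine ⟨z.1 * cs.simple s, Sum.inl z.2, (desc_mul cs _ _).2 h, ?_⟩
    simp [out, mul_assoc]

lemma simple_mul_ne (w : W) (s : S) : w * cs.simple s ≠ w := by
  intro h
  have h1 := desc_mul cs w s
  rw [h] at h1
  tauto

lemma out_inj (s : S) (w : W) : Function.Injective (out cs w s) := by
  rintro (x | x) (y | y) h <;> simp [out] at h ⊢
  · exact h
  · have := h.1
    exact absurd (by rw [this, mul_one]) (simple_mul_ne cs w s)
  · have := h.1
    exact absurd (by rw [this, mul_one]) (simple_mul_ne cs w s)
  · exact h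

lemma act_mul (s : S) (p q : W → Equiv.Perm (ℕ ⊕ ℕ)) (z : W × ℕ) :
    act cs s p (act cs s q z) = act cs s (p * q) z := by
  obtain ⟨w, y, hw, rfl⟩ := exists_out cs s z
  rw [act_out cs s _ w hw, act_out cs s _ w hw, act_out cs s _ w hw]; rfl

lemma act_one (s : S) (z : W × ℕ) : act cs s 1 z = z := by
  obtain ⟨w, y, hw, rfl⟩ := exists_out cs s z
  rw [act_out cs s _ w hw]; rfl

/-- block action as homomorphism -/
noncomputable def actH (s : S) : (W → Equiv.Perm (ℕ ⊕ ℕ)) →* Equiv.Perm (W × ℕ) where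
  toFun p := ⟨act cs s p, act cs s p⁻¹, fun z => by rw [act_mul, inv_mul_cancel, act_one],
    fun z => by rw [act_mul, mul_inv_cancel, act_one]⟩
  map_one' := by ext1 z; exact act_one cs s z
  map_mul' p q := by ext1 z; exact (act_mul cs s p q z).symm

/-- global permutation -/
noncomputable def sg (f : W → S → Equiv.Perm (ℕ ⊕ ℕ)) (s : S) : Equiv.Perm (W × ℕ) :=
  actH cs s (fun w => f w s)

lemma sg_zpow (f : W → S → Equiv.Perm (ℕ ⊕ ℕ)) (s : S) (k : ℤ) (w : W) (hw : cs.IsRightDescent w s)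
    (y : ℕ ⊕ ℕ) : (sg cs f s ^ k) (out cs w s y) = out cs w s ((f w s ^ k) y) := by
  rw [sg, ← map_zpow]
  exact act_out cs s _ w hw y

lemma sg_out (f : W → S → Equiv.Perm (ℕ ⊕ ℕ)) (s : S) (w : W) (hw : cs.IsRightDescent w s)
    (y : ℕ ⊕ ℕ) : (sg cs f s) (out cs w s y) = out cs w s ((f w s) y) := by
  exact act_out cs s (fun w => f w s) w hw y

/-- property P1 -/
structure P1 (p : Equiv.Perm (ℕ ⊕ ℕ)) : Prop where
  low : ∀ k : ℤ, k ≠ 0 → ∀ x y, (p ^ k) (Sum.inl x) ≠ Sum.inl y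
  free : ∀ k : ℤ, k ≠ 0 → ∀ z, (p ^ k) z ≠ z

lemma exists_P1 : ∃ p, P1 p := by
  have e : {z : ℕ × ℤ // z.2 ≠ 0} ≃ ℕ := by
    have : Infinite {z : ℕ × ℤ // z.2 ≠ 0} :=
      Infinite.of_injective (fun n : ℕ => (⟨(n, 1), by simp⟩ : {z : ℕ × ℤ // z.2 ≠ 0}))
        (fun a b h => by simpa using h)
    exact (nonempty_equiv_of_countable (α := {z : ℕ × ℤ // z.2 ≠ 0}) (β := ℕ)).some
  let ψ : ℕ ⊕ ℕ → ℕ × ℤ := Sum.elim (fun x => (x, 0)) (fun x => (e.symm x).1)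
  have hψ : Function.Bijective ψ := by
    constructor
    · rintro (x | x) (y | y) h <;> simp [ψ] at h ⊢
      · exact h
      · exact (e.symm y).2 (by rw [← h])
      · exact (e.symm x).2 (by rw [h])
      · simpa using Subtype.ext h
    · rintro ⟨a, b⟩
      by_cases h : b = 0
      · subst h; exact ⟨Sum.inl a, rfl⟩
      · exact ⟨Sum.inr (e ⟨(a, b), h⟩), by simp [ψ]⟩
  let E := Equiv.ofBijective ψ hψ
  let L : Equiv.Perm (ℕ × ℤ) := ⟨fun z => (z.1, z.2 + 1), fun z => (z.1, z.2 - 1), fun z => by simp,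
    fun z => by simp⟩
  have hL : ∀ (k : ℤ) z, (L ^ k) z = (z.1, z.2 + k) := by
    intro k
    induction k with
    | zero => intro z; simp
    | succ k ih => intro z; rw [zpow_add_one, Equiv.Perm.mul_apply, ih]; simp [L]; ring
    | pred k ih =>
      intro z; rw [zpow_sub_one, Equiv.Perm.mul_apply, ih]
      have : L⁻¹ z = (z.1, z.2 - 1) := rfl
      rw [this]; simp; ring
  let p : Equiv.Perm (ℕ ⊕ ℕ) := E.symm.permCongrHom L
  have hp : ∀ (k : ℤ) z, ψ ((p ^ k) z) = ((ψ z).1, (ψ z).2 + k) := by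
    intro k z
    rw [← hL]
    have : p ^ k = E.symm.permCongrHom (L ^ k) := (map_zpow _ _ _).symm
    rw [this]
    show E (E.symm _) = _
    rw [Equiv.apply_symm_apply]; rfl
  refine ⟨p, ?_, ?_⟩
  · intro k hk x y h
    have := hp k (Sum.inl x)
    rw [h] at this
    simp [ψ] at this
    exact hk this.2.symm
  · intro k hk z h
    have := hp k z
    rw [h] at this
    have := congrArg Prod.snd this
    simp at this
    exact hk this

variable {cs} {f : W → S → Equiv.Perm (ℕ ⊕ ℕ)}

lemma out_inr (w : W) (s : S) (x : ℕ) : out cs w s (Sum.inr x) = (w, x) := rfl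
lemma out_inl (w : W) (s : S) (x : ℕ) : out cs w s (Sum.inl x) = (w * cs.simple s, x) := rfl

lemma sg_free (hP : ∀ w s, P1 (f w s)) (s : S) (k : ℤ) (hk : k ≠ 0) (z : W × ℕ) :
    (sg cs f s ^ k) z ≠ z := by
  obtain ⟨w, y, hw, rfl⟩ := exists_out cs s z
  rw [sg_zpow cs f s k w hw]
  intro h
  exact (hP w s).free k hk y (out_inj cs s w h)

lemma sg_low (hP : ∀ w s, P1 (f w s)) (s : S) (k : ℤ) (hk : k ≠ 0) (z : W × ℕ)
    (hz : ¬ cs.IsRightDescent z.1 s) :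
    ((sg cs f s ^ k) z).1 = z.1 * cs.simple s := by
  have h1 := (desc_mul cs _ _).2 hz
  have : z = out cs (z.1 * cs.simple s) s (Sum.inl z.2) := by simp [out, mul_assoc]
  obtain ⟨y, hy⟩ : ∃ y, (f (z.1 * cs.simple s) s ^ k) (Sum.inl z.2) = Sum.inr y := by
    rcases h : (f (z.1 * cs.simple s) s ^ k) (Sum.inl z.2) with y | y
    · exact absurd h ((hP _ s).low k hk _ y)
    · exact ⟨y, rfl⟩
  rw [this, sg_zpow cs f s k _ h1, hy, ← this]; rfl

lemma sg_fst (s : S) (k : ℤ) (z : W × ℕ) :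
    ((sg cs f s ^ k) z).1 = z.1 ∨ ((sg cs f s ^ k) z).1 = z.1 * cs.simple s := by
  obtain ⟨w, y, hw, rfl⟩ := exists_out cs s z
  rw [sg_zpow cs f s k w hw]
  rcases y with x | x <;> rcases (f w s ^ k) _ with y | y <;> simp [out, mul_assoc]

end act
end Ext


namespace Ext

lemma transport {X Y : Type*} (ψ : X → Y) (hψ : Function.Injective ψ) (L : Equiv.Perm Y)
    (h1 : ∀ x, ∃ x', ψ x' = L (ψ x)) (h2 : ∀ x, ∃ x', ψ x' = L⁻¹ (ψ x)) :
    ∃ p : Equiv.Perm X, ∀ (k : ℤ) x, ψ ((p ^ k) x) = (L ^ k) (ψ x) := by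
  choose g hg using h1
  choose g' hg' using h2
  let p : Equiv.Perm X := ⟨g, g', fun x => hψ (by rw [hg', hg]; exact L.symm_apply_apply _),
    fun x => hψ (by rw [hg, hg']; exact L.apply_symm_apply _)⟩
  have hp : ∀ x, ψ (p x) = L (ψ x) := hg
  have hp' : ∀ x, ψ (p⁻¹ x) = L⁻¹ (ψ x) := hg'
  refine ⟨p, fun k => ?_⟩
  induction k with
  | zero => intro z; simp
  | succ k ih => intro z; rw [zpow_add_one, Equiv.Perm.mul_apply, ih, hp, zpow_add_one]; rfl
  | pred k ih => intro z; rw [zpow_sub_one, Equiv.Perm.mul_apply, ih, hp', zpow_sub_one]; rfl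

section act
variable {S : Type*} [Fintype S] [DecidableEq S] {M : CoxeterMatrix S} {W : Type*} [Group W]
  (cs : CoxeterSystem M W)

/-- left multiplication -/
def Lm {Z A : Type*} [Group A] : A →* Equiv.Perm (Z × A × ℕ) where
  toFun g := ⟨fun z => (z.1, g * z.2.1, z.2.2), fun z => (z.1, g⁻¹ * z.2.1, z.2.2),
    fun z => by simp, fun z => by simp⟩
  map_one' := by ext1 z; simp
  map_mul' g h := by ext1 z; simp [mul_assoc]

lemma Lm_apply {Z A : Type*} [Group A] (g : A) (z : Z × A × ℕ) :
    Lm g z = (z.1, g * z.2.1, z.2.2) := rfl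

lemma altWord_intertwine {X Y : Type*} (P : X → Prop) (Θ : X → Y) (σ : Bool → Equiv.Perm X)
    (L : Bool → Equiv.Perm Y) (h : ∀ d x, P x → P (σ d x) ∧ Θ (σ d x) = L d (Θ x)) (d : Bool) (n : ℕ)
    (x : X) (hx : P x) : P (altWord (σ d) (σ !d) n x) ∧
      Θ (altWord (σ d) (σ !d) n x) = altWord (L d) (L !d) n (Θ x) := by
  induction n generalizing d with
  | zero => exact ⟨hx, rfl⟩
  | succ n ih =>
    have := ih (!d)
    rw [Bool.not_not] at this
    have h2 := h d _ this.1
    rw [this.2] at h2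
    exact h2

theorem extend (f : W → S → Equiv.Perm (ℕ ⊕ ℕ)) (hP : ∀ w s, P1 (f w s)) (w : W) (s t : S)
    (hst : s ≠ t) (hs : cs.IsRightDescent w s) (ht : cs.IsRightDescent w t) :
    ∃ p q : Equiv.Perm (ℕ ⊕ ℕ), P1 p ∧ P1 q ∧ ∀ f' : W → S → Equiv.Perm (ℕ ⊕ ℕ),
      (∀ u, cs.length u < cs.length w → f' u = f u) → f' w s = p → f' w t = q →
      ∀ z : W × ℕ, z.1 ∈ Cox.Kc cs w s t → altWord (sg cs f' s) (sg cs f' t) (M s t) z =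
        altWord (sg cs f' t) (sg cs f' s) (M s t) z := by
  classical
  obtain ⟨hm0, hco⟩ := Cox.coset_props cs hst hs ht
  have hm1 : M s t ≠ 1 := M.off_diagonal s t hst
  set m := M s t with hm
  have hm2 : 2 ≤ m := by omega
  obtain ⟨A, _, _, as, at', hbr, hg1, hg2⟩ := Dih.exists_good m hm2
  let dd : Bool → S := fun b => if b then s else t
  let a : Bool → A := fun b => if b then as else at'
  have hA : ∀ d, Dih.Good m (a d) (a !d) := by
    intro d; cases d
    · exact hg2
    · exact hg1
  have hdw : ∀ d, cs.IsRightDescent w (dd d) := by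
    intro d; cases d
    · exact ht
    · exact hs
  set K := Cox.Kc cs w s t with hK
  have hKd : ∀ d u, u ∈ K → u * cs.simple (dd d) ∈ K := by
    intro d; cases d
    · exact fun u h => Cox.Kc_mul_right cs h
    · exact fun u h => Cox.Kc_mul_left cs h
  have hwK : w ∈ K := Cox.Kc_self cs w s t
  let Z0 : W × ℕ → Prop := fun z => z.1 ∈ K ∧ z.1 ≠ w
  let lev : W × ℕ → ℕ := fun z => cs.length z.1 + m - cs.length w
  let Ds : W × ℕ → Bool → Prop := fun z d => cs.IsRightDescent z.1 (dd d)
  let σ : Bool → Equiv.Perm (W × ℕ) := fun d => sg cs f (dd d)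
  have hlen : ∀ (v : W) d, cs.IsRightDescent v (dd d) →
      cs.length (v * cs.simple (dd d)) + 1 = cs.length v := by
    intro v d hd
    exact cs.isRightDescent_iff.mp hd
  have H : Hyp σ lev Ds Z0 m := by
    constructor
    · rintro z d ⟨hz1, hz2⟩ hd k
      have hb : z.1 * cs.simple (dd d) ∈ K := hKd d _ hz1
      have hb2 := hlen _ _ hd
      have c1 := (hco _ hz1).1
      have c2 := (hco _ hb).1
      have c3 := ((hco _ hz1).2 hz2).1
      rcases sg_fst (cs := cs) (f := f) (dd d) k z with h | h
      · refine ⟨⟨h ▸ hz1, h ▸ hz2⟩, Or.inl ⟨?_, ?_⟩⟩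
        · show cs.length _ + m - _ = cs.length _ + m - _
          rw [h]
        · show cs.IsRightDescent _ _
          rw [h]; exact hd
      · refine ⟨⟨h ▸ hb, ?_⟩, Or.inr ⟨?_, ?_⟩⟩
        · rw [h]; intro h'; rw [h'] at hb2; omega
        · show cs.length _ + m - _ + 1 = cs.length _ + m - _
          rw [h]
          omega
        · show ¬ cs.IsRightDescent _ _
          rw [h, desc_mul, not_not]; exact hd
    · intro z d k hd hk
      show cs.IsRightDescent _ _
      rw [sg_low hP _ k hk z hd, desc_mul]; exact hd
    · intro z d k hk
      exact sg_free hP _ k hk z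
    · rintro z d d' ⟨hz1, hz2⟩ h1 h2
      have := ((hco _ hz1).2 hz2).2
      cases d <;> cases d'
      · rfl
      · exact absurd ⟨h2, h1⟩ this
      · exact absurd ⟨h1, h2⟩ this
      · rfl
    · rintro z ⟨hz1, hz2⟩
      have := ((hco _ hz1).2 hz2).1
      show cs.length _ + m - _ < m
      omega
  have hpos : ∀ z d, Z0 z → Ds z d → 1 ≤ lev z := by
    rintro z d ⟨hz1, hz2⟩ hd
    have hb : z.1 * cs.simple (dd d) ∈ K := hKd d _ hz1
    have hb2 := hlen _ _ hd
    have c2 := (hco _ hb).1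
    show 1 ≤ cs.length _ + m - _
    omega
  -- the big set
  let ι : W × ℕ → ((W × ℕ) × A × ℕ) := fun z => ((R σ lev Ds a z).1, (R σ lev Ds a z).2, 0)
  have hι : ∀ z z', Z0 z → Z0 z' → ι z = ι z' → z = z' := by
    intro z z' hz hz' e
    apply R_inj a H hm2 hpos hA hz hz'
    simp only [ι, Prod.mk.injEq] at e
    exact Prod.ext e.1 e.2.1
  let U : Set ((W × ℕ) × A × ℕ) := {y | ¬ ∃ z, Z0 z ∧ ι z = y}
  have hWc : Countable W := by
    have : Countable S := inferInstance
    exact cs.wordProd_surjective.countable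
  have hUi : Infinite U := by
    refine Infinite.of_injective (fun n : ℕ => (⟨((w, 0), 1, n + 1), ?_⟩ : U)) ?_
    · rintro ⟨z, -, h⟩
      simp [ι] at h
    · intro x y h
      simpa using h
  have e : U ≃ ℕ := (nonempty_equiv_of_countable (α := U) (β := ℕ)).some
  let Θ : W × ℕ → ((W × ℕ) × A × ℕ) := fun z => if z.1 = w then (e.symm z.2).1 else ι z
  have hΘw : ∀ x, Θ (w, x) = (e.symm x).1 := fun x => if_pos rfl
  have hΘi : ∀ z, Z0 z → Θ z = ι z := fun z hz => if_neg hz.2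
  have hΘinj : ∀ z z', z.1 ∈ K → z'.1 ∈ K → Θ z = Θ z' → z = z' := by
    rintro ⟨v, x⟩ ⟨v', x'⟩ h1 h2 h
    by_cases c1 : v = w <;> by_cases c2 : v' = w
    · subst c1 c2
      rw [hΘw, hΘw] at h
      rw [e.symm.injective (Subtype.ext h)]
    · subst c1
      rw [hΘw, hΘi _ ⟨h2, c2⟩] at h
      exact absurd ⟨_, ⟨h2, c2⟩, h.symm⟩ (e.symm x).2
    · subst c2
      rw [hΘw, hΘi _ ⟨h1, c1⟩] at h
      exact absurd ⟨_, ⟨h1, c1⟩, h⟩ (e.symm x').2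
    · rw [hΘi _ ⟨h1, c1⟩, hΘi _ ⟨h2, c2⟩] at h
      exact hι _ _ ⟨h1, c1⟩ ⟨h2, c2⟩ h
  have hΘsurj : ∀ y, ∃ z, z.1 ∈ K ∧ Θ z = y := by
    intro y
    by_cases h : ∃ z, Z0 z ∧ ι z = y
    · obtain ⟨z, hz, rfl⟩ := h
      exact ⟨z, hz.1, hΘi z hz⟩
    · exact ⟨(w, e ⟨y, h⟩), hwK, by rw [hΘw]; simp⟩
  let L : Bool → Equiv.Perm ((W × ℕ) × A × ℕ) := fun d => Lm (a d)
  have hLz : ∀ d (k : ℤ), L d ^ k = Lm (a d ^ k) := fun d k => (map_zpow _ _ _).symm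
  -- away from the top
  have haway : ∀ d z, Z0 z → z.1 ≠ w * cs.simple (dd d) → ∀ k : ℤ, Z0 ((σ d ^ k) z) ∧
      ((σ d ^ k) z).1 ≠ w * cs.simple (dd d) ∧ ι ((σ d ^ k) z) = (L d ^ k) (ι z) := by
    intro d z hz hzd k
    have hzd' : z.1 * cs.simple (dd d) ≠ w := by
      intro h; apply hzd; rw [← h, mul_assoc, cs.simple_mul_simple_self, mul_one]
    refine ⟨⟨?_, ?_⟩, ?_, ?_⟩
    · rcases sg_fst (cs := cs) (f := f) (dd d) k z with h | h
      · rw [h]; exact hz.1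
      · rw [h]; exact hKd d _ hz.1
    · rcases sg_fst (cs := cs) (f := f) (dd d) k z with h | h
      · rw [h]; exact hz.2
      · rw [h]; exact hzd'
    · rcases sg_fst (cs := cs) (f := f) (dd d) k z with h | h
      · rw [h]; exact hzd
      · rw [h]; intro h'; exact hz.2 (mul_right_cancel h')
    · rw [hLz, Lm_apply]
      by_cases hd : Ds z d
      · simp only [ι, R_equiv a H hz hd k]
      · have h1 : Ds ((σ d ^ (1:ℤ)) z) d := H.low z d 1 hd one_ne_zero
        have h2 : Z0 ((σ d ^ (1:ℤ)) z) := by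
          have := sg_low hP (dd d) 1 one_ne_zero z hd
          exact ⟨by rw [this]; exact hKd d _ hz.1, by rw [this]; exact hzd'⟩
        have e1 := R_equiv a H h2 h1 (-1)
        have e2 := R_equiv a H h2 h1 (k - 1)
        rw [← Equiv.Perm.mul_apply, ← zpow_add] at e1 e2
        rw [sub_add_cancel] at e2
        rw [neg_add_cancel, zpow_zero, Equiv.Perm.coe_one, id_eq] at e1
        simp only [ι, e2, e1, ← mul_assoc, ← zpow_add]
        simp [sub_eq_add_neg]
  -- psi
  have hout : ∀ d y, (out cs w (dd d) y).1 ∈ K := by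
    rintro d (x | x)
    · exact hKd d _ hwK
    · exact hwK
  let ψ : Bool → ℕ ⊕ ℕ → ((W × ℕ) × A × ℕ) := fun d y => Θ (out cs w (dd d) y)
  have hψ : ∀ d, Function.Injective (ψ d) := by
    intro d y y' h
    exact out_inj cs _ _ (hΘinj _ _ (hout d y) (hout d y') h)
  have hψr : ∀ d z, z.1 ∈ K → (¬ ∃ y, out cs w (dd d) y = z) →
      Z0 z ∧ z.1 ≠ w * cs.simple (dd d) := by
    rintro d ⟨v, x⟩ hz h
    refine ⟨⟨hz, ?_⟩, ?_⟩
    · rintro rfl; exact h ⟨Sum.inr x, rfl⟩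
    · intro h'
      simp only at h'
      subst h'
      exact h ⟨Sum.inl x, rfl⟩
  have hrange : ∀ d (k : ℤ) y, ∃ y', ψ d y' = (L d ^ k) (ψ d y) := by
    intro d k y
    obtain ⟨z, hz, hzy⟩ := hΘsurj ((L d ^ k) (ψ d y))
    by_cases h : ∃ y, out cs w (dd d) y = z
    · obtain ⟨y', rfl⟩ := h
      exact ⟨y', hzy⟩
    · exfalso
      obtain ⟨h1, h2⟩ := hψr d z hz h
      obtain ⟨g1, g2, g3⟩ := haway d z h1 h2 (-k)
      rw [← hΘi z h1, hzy, ← Equiv.Perm.mul_apply, ← zpow_add, neg_add_cancel, zpow_zero,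
        Equiv.Perm.coe_one, id_eq, ← hΘi _ g1] at g3
      have := hΘinj _ _ g1.1 (hout d y) g3
      rw [this] at g1 g2
      rcases y with x | x
      · exact g2 rfl
      · exact g1.2 rfl
  have hp : ∀ d, ∃ p : Equiv.Perm (ℕ ⊕ ℕ), ∀ (k : ℤ) x, ψ d ((p ^ k) x) = (L d ^ k) (ψ d x) := by
    intro d
    apply transport (ψ d) (hψ d) (L d)
    · intro x; simpa using hrange d 1 x
    · intro x; simpa using hrange d (-1) x
  choose p hp using hp
  have hP1 : ∀ d, P1 (p d) := by
    intro d
    have hd0 : ¬ cs.IsRightDescent (w * cs.simple (dd d)) (dd d) := by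
      rw [desc_mul, not_not]; exact hdw d
    have hz0 : ∀ x, Z0 (w * cs.simple (dd d), x) := fun x => ⟨hKd d _ hwK, simple_mul_ne cs _ _⟩
    constructor
    · intro k hk x y h
      have h1 := hp d k (Sum.inl x)
      rw [h] at h1
      simp only [ψ, out_inl, hΘi _ (hz0 _), hLz, Lm_apply] at h1
      have := congrArg (fun y : ((W × ℕ) × A × ℕ) => y.2.1) h1
      exact R_top a H hm2 hpos hA (hz0 x) (hz0 y) d hd0 hd0 k hk this.symm
    · intro k hk z h
      have h1 := hp d k z
      rw [h, hLz, Lm_apply] at h1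
      have := congrArg (fun y : ((W × ℕ) × A × ℕ) => y.2.1) h1
      simp only at this
      have h3 : a d ^ k = 1 := by
        rwa [eq_comm, mul_eq_right] at this
      apply Dih.Good.top hm2 (hA d) [] [] (by simp) (by simp) (by simp; omega) (by simp; omega) k hk
      simp [altP, h3]
  refine ⟨p true, p false, hP1 true, hP1 false, ?_⟩
  intro f' hf' hf1 hf2 z hz
  have hfd : ∀ d, f' w (dd d) = p d := by
    intro d; cases d
    · exact hf2
    · exact hf1
  have step : ∀ d (x : W × ℕ), x.1 ∈ K → (sg cs f' (dd d) x).1 ∈ K ∧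
      Θ (sg cs f' (dd d) x) = L d (Θ x) := by
    intro d x hx
    by_cases h : ∃ y, out cs w (dd d) y = x
    · obtain ⟨y, rfl⟩ := h
      rw [sg_out cs f' _ w (hdw d), hfd]
      refine ⟨hout d _, ?_⟩
      have := hp d 1 y
      simpa only [zpow_one] using this
    · obtain ⟨h1, h2⟩ := hψr d x hx h
      obtain ⟨g1, g2, g3⟩ := haway d x h1 h2 1
      rw [zpow_one, zpow_one] at g3
      rw [zpow_one] at g1
      have : sg cs f' (dd d) x = σ d x := by
        obtain ⟨v, y, hv, rfl⟩ := exists_out cs (dd d) x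
        have hvK : v ∈ K := by
          rcases y with y | y
          · have := hKd d _ hx
            simpa [out, mul_assoc] using this
          · exact hx
        have hvw : v ≠ w := by
          rintro rfl; exact h ⟨y, rfl⟩
        show _ = sg cs f (dd d) _
        rw [sg_out cs f' _ v hv, sg_out cs f _ v hv, hf' v ((hco v hvK).2 hvw).1]
      rw [this]
      exact ⟨g1.1, by rw [hΘi _ g1, hΘi _ h1, g3]⟩
  have h1 := altWord_intertwine (fun x : W × ℕ => x.1 ∈ K) Θ (fun d => sg cs f' (dd d)) L step true m z hz
  have h2 := altWord_intertwine (fun x : W × ℕ => x.1 ∈ K) Θ (fun d => sg cs f' (dd d)) L step false m z hz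
  apply hΘinj _ _ h1.1 h2.1
  refine h1.2.trans (Eq.trans ?_ h2.2.symm)
  have hb : altWord (L true) (L !true) m = altWord (L false) (L !false) m := by
    have := congrArg (Lm (Z := W × ℕ)) hbr
    rw [map_altWord, map_altWord] at this
    exact this
  rw [hb]

end act
end Ext


namespace Ext

section act
variable {S : Type*} [Fintype S] [DecidableEq S] {M : CoxeterMatrix S} {W : Type*} [Group W]
  (cs : CoxeterSystem M W)

/-- braid relation at a coset -/
def BraidAt (f : W → S → Equiv.Perm (ℕ ⊕ ℕ)) (w : W) (s t : S) : Prop :=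
  ∀ z : W × ℕ, z.1 ∈ Cox.Kc cs w s t → altWord (sg cs f s) (sg cs f t) (M s t) z =
        altWord (sg cs f t) (sg cs f s) (M s t) z

lemma BraidAt.swap {f : W → S → Equiv.Perm (ℕ ⊕ ℕ)} {w : W} {s t : S} (h : BraidAt cs f w s t) :
    BraidAt cs f w t s := by
  intro z hz
  rw [Cox.Kc_swap] at hz
  rw [M.symmetric t s]
  exact (h z hz).symm

/-- two-dimensionality -/
def TwoDim (M : CoxeterMatrix S) : Prop := ∀ s t r, s ≠ t → t ≠ r → s ≠ r →
  (M s t:ℝ)⁻¹ + (M t r:ℝ)⁻¹ + (M s r:ℝ)⁻¹ ≤ 1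

theorem extend2 (h2 : TwoDim M) (f : W → S → Equiv.Perm (ℕ ⊕ ℕ)) (hP : ∀ w s, P1 (f w s)) (w : W) :
    ∃ p : S → Equiv.Perm (ℕ ⊕ ℕ), (∀ s, P1 (p s)) ∧ ∀ s t, s ≠ t → cs.IsRightDescent w s →
      cs.IsRightDescent w t → ∀ f' : W → S → Equiv.Perm (ℕ ⊕ ℕ),
      (∀ u, cs.length u < cs.length w → f' u = f u) → f' w = p → BraidAt cs f' w s t := by
  obtain ⟨p0, hp0⟩ := exists_P1
  by_cases h : ∃ s t, s ≠ t ∧ cs.IsRightDescent w s ∧ cs.IsRightDescent w t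
  · obtain ⟨s, t, hst, hs, ht⟩ := h
    obtain ⟨p, q, h1, h3, h4⟩ := extend cs f hP w s t hst hs ht
    refine ⟨fun r => if r = s then p else if r = t then q else p0, ?_, ?_⟩
    · intro r
      simp only
      split_ifs <;> assumption
    · intro s' t' hst' hs' ht' f' hf hw
      have hmem : ∀ r, cs.IsRightDescent w r → r = s ∨ r = t := by
        intro r hr
        by_contra hne
        rw [not_or] at hne
        exact Cox.no_three cs hst (Ne.symm hne.2) (Ne.symm hne.1)
          (h2 s t r hst (Ne.symm hne.2) (Ne.symm hne.1)) hs ht hr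
      have hb : BraidAt cs f' w s t := h4 f' hf (by rw [hw]; simp) (by rw [hw]; simp [hst.symm])
      rcases hmem s' hs' with rfl | rfl <;> rcases hmem t' ht' with rfl | rfl
      · exact absurd rfl hst'
      · exact hb
      · exact hb.swap
      · exact absurd rfl hst'
  · exact ⟨fun _ => p0, fun _ => hp0, fun s t h1 h3 h4 => absurd ⟨s, t, h1, h3, h4⟩ h⟩

theorem exists_f (h2 : TwoDim M) : ∃ f : W → S → Equiv.Perm (ℕ ⊕ ℕ), (∀ w s, P1 (f w s)) ∧
    ∀ w s t, s ≠ t → cs.IsRightDescent w s → cs.IsRightDescent w t → BraidAt cs f w s t := by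
  classical
  obtain ⟨p0, hp0⟩ := exists_P1
  let T := {p : S → Equiv.Perm (ℕ ⊕ ℕ) // ∀ s, P1 (p s)}
  let d0 : T := ⟨fun _ => p0, fun _ => hp0⟩
  have key : ∀ (f : W → T) (w : W), ∃ p : T, ∀ s t, s ≠ t → cs.IsRightDescent w s →
      cs.IsRightDescent w t → ∀ f' : W → S → Equiv.Perm (ℕ ⊕ ℕ),
      (∀ u, cs.length u < cs.length w → f' u = (f u).1) → f' w = p.1 → BraidAt cs f' w s t := by
    intro f w
    obtain ⟨p, h1, h3⟩ := extend2 cs h2 (fun u => (f u).1) (fun u s => (f u).2 s) w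
    exact ⟨⟨p, h1⟩, h3⟩
  choose nx hnx using key
  have wf : WellFounded (fun u v : W => cs.length u < cs.length v) := (measure cs.length).wf
  let F : W → T := wf.fix (fun w ih => nx (fun u => if h : cs.length u < cs.length w then ih u h else d0) w)
  have hF : ∀ w, F w = nx (fun u => if h : cs.length u < cs.length w then F u else d0) w :=
    fun w => wf.fix_eq _ w
  refine ⟨fun w => (F w).1, fun w s => (F w).2 s, ?_⟩
  intro w s t h1 hs ht
  apply hnx (fun u => if h : cs.length u < cs.length w then F u else d0) w s t h1 hs ht
  · intro u hu
    simp only [dif_pos hu]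
  · simp only [← hF w]

theorem exists_sigma (h2 : TwoDim M) : ∃ σ : S → Equiv.Perm (W × ℕ),
    (∀ s t, s ≠ t → M s t ≠ 0 → altWord (σ s) (σ t) (M s t) = altWord (σ t) (σ s) (M s t)) ∧
    ∀ s (k : ℤ) z, k ≠ 0 → ¬ cs.IsRightDescent (Prod.fst z) s →
      ((σ s ^ k) z).1 = z.1 * cs.simple s := by
  obtain ⟨f, hP, hB⟩ := exists_f cs h2
  refine ⟨sg cs f, ?_, fun s k z hk hz => sg_low hP s k hk z hz⟩
  intro s t hst h0
  ext1 z
  obtain ⟨w, hs, ht, hw⟩ := Cox.exists_top cs z.1 h0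
  exact hB w s t hst hs ht z hw
end act
end Ext


namespace Art

variable {S : Type*} [Fintype S]

lemma altWord_of {G : Type*} [Group G] {M : S → S → ℕ∞} (σ : S → G)
    (h : ∀ s t, s ≠ t → ∀ n : ℕ, M s t = n → altWord (σ s) (σ t) n = altWord (σ t) (σ s) n) :
    ∀ r ∈ artinRels M, FreeGroup.lift σ r = 1 := by
  rintro r ⟨s, t, hst, n, hn, rfl⟩
  rw [map_mul, map_inv, map_altWord, map_altWord, mul_inv_eq_one]
  simpa using h s t hst n hn

open Classical in
/-- The Coxeter matrix. -/
noncomputable def CM (M : S → S → ℕ∞) (hsymm : ∀ a b : S, M a b = M b a)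
    (htwo : ∀ a b : S, a ≠ b → 2 ≤ M a b) : CoxeterMatrix S where
  M := Matrix.of (fun s t => if s = t then 1 else (M s t).toNat)
  isSymm := by
    ext s t
    simp only [Matrix.transpose_apply, Matrix.of_apply, hsymm s t, eq_comm]
  diagonal s := by simp
  off_diagonal s t hst := by
    simp only [Matrix.of_apply, if_neg hst]
    have := htwo s t hst
    intro h
    rcases hM : M s t with _ | n
    · rw [hM] at h
      have h5 : (0 : ℕ) = 1 := h
      omega
    · rw [hM] at h this
      have h3 : (2 : ℕ∞) ≤ (n : ℕ∞) := this
      have h4 : n = 1 := h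
      subst h4
      norm_num at h3

lemma CM_apply (M : S → S → ℕ∞) (hsymm : ∀ a b : S, M a b = M b a)
    (htwo : ∀ a b : S, a ≠ b → 2 ≤ M a b) {s t : S} (hst : s ≠ t) :
    CM M hsymm htwo s t = (M s t).toNat := by
  simp [CM, hst]

lemma inv_conv (n : ℕ∞) (hn : n ≠ 0) : (((n : ℕ∞) : ℝ≥0∞))⁻¹ = ENNReal.ofReal ((n.toNat : ℝ)⁻¹) := by
  rcases n with _ | n
  · show ((⊤ : ℕ∞) : ℝ≥0∞)⁻¹ = ENNReal.ofReal (((⊤ : ℕ∞).toNat : ℝ)⁻¹)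
    simp
  · show (((n : ℕ∞)) : ℝ≥0∞)⁻¹ = ENNReal.ofReal ((((n : ℕ∞)).toNat : ℝ)⁻¹)
    have : 0 < n := by
      rcases Nat.eq_zero_or_pos n with h | h
      · subst h; exact absurd rfl hn
      · exact h
    rw [ENat.toNat_coe, ENNReal.ofReal_inv_of_pos (by exact_mod_cast this)]
    simp

variable {M : S → S → ℕ∞} (hsymm : ∀ a b : S, M a b = M b a) (htwo : ∀ a b : S, a ≠ b → 2 ≤ M a b)

lemma twoDim (h2dim : TwoDimensional M) : Ext.TwoDim (CM M hsymm htwo) := by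
  intro s t r hst htr hsr
  have h := h2dim s t r hst htr hsr
  have nz : ∀ a b, a ≠ b → M a b ≠ 0 := by
    intro a b hab h0
    have := htwo a b hab
    rw [h0] at this
    simp at this
  rw [CM_apply _ _ _ hst, CM_apply _ _ _ htr, CM_apply _ _ _ hsr]
  rw [inv_conv _ (nz s t hst), inv_conv _ (nz t r htr), inv_conv _ (nz s r hsr),
    ← ENNReal.ofReal_add (by positivity) (by positivity),
    ← ENNReal.ofReal_add (by positivity) (by positivity)] at h
  rwa [ENNReal.ofReal_le_one] at h

/-- The generator. -/
abbrev gen (M : S → S → ℕ∞) (s : S) : ArtinGroup M := PresentedGroup.of s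

theorem exists_level {M : S → S → ℕ∞} (hsymm : ∀ a b : S, M a b = M b a) (htwo : ∀ a b : S, a ≠ b → 2 ≤ M a b)
    (h2dim : TwoDimensional M) : ∃ (lam : ArtinGroup M → ℕ) (D : ArtinGroup M → S → Prop),
    (∀ g s (k : ℤ), k ≠ 0 → ¬ D g s → lam g < lam (g * gen M s ^ k)) ∧
    ∀ g s t r, s ≠ t → t ≠ r → s ≠ r → D g s → D g t → D g r → False := by
  classical
  set cs := (CM M hsymm htwo).toCoxeterSystem
  have h2 := twoDim hsymm htwo h2dim
  obtain ⟨σ, h1, h3⟩ := Ext.exists_sigma cs h2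
  have hrel := altWord_of (M := M) σ (by
    intro s t hst n hn
    have e : CM M hsymm htwo s t = n := by rw [CM_apply _ _ _ hst, hn]; rfl
    have := h1 s t hst (by
      rw [e]
      rintro rfl
      have := htwo s t hst
      rw [hn] at this
      simp at this)
    rwa [e] at this)
  let Φ : ArtinGroup M →* Equiv.Perm ((CM M hsymm htwo).Group × ℕ) := PresentedGroup.toGroup hrel
  have hΦ : ∀ s, Φ (gen M s) = σ s := fun s => PresentedGroup.toGroup.of hrel
  let δ : ArtinGroup M → (CM M hsymm htwo).Group := fun g => (Φ g⁻¹ (1, 0)).1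
  refine ⟨fun g => cs.length (δ g), fun g s => cs.IsRightDescent (δ g) s, ?_, ?_⟩
  · intro g s k hk hd
    have : δ (g * gen M s ^ k) = δ g * cs.simple s := by
      have := h3 s (-k) (Φ g⁻¹ (1, 0)) (by omega) hd
      rw [← this]
      show (Φ (g * gen M s ^ k)⁻¹ (1, 0)).1 = _
      rw [mul_inv_rev, map_mul, Equiv.Perm.mul_apply, ← zpow_neg, map_zpow, hΦ]
    simp only [this]
    have := (Ext.desc_mul cs (δ g) s).2 hd
    rw [cs.isRightDescent_iff, mul_assoc, cs.simple_mul_simple_self, mul_one] at this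
    omega
  · intro g s t r hst htr hsr a b c
    exact Cox.no_three cs hst htr hsr (h2 s t r hst htr hsr) a b c

/-- The vanishing argument. -/
theorem vanish {G : Type*} [Group G] (γ : S → G) (lam : G → ℕ) (D : G → S → Prop)
    (hD : ∀ g s (k : ℤ), k ≠ 0 → ¬ D g s → lam g < lam (g * γ s ^ k))
    (h3 : ∀ g s t r, s ≠ t → t ≠ r → s ≠ r → D g s → D g t → D g r → False)
    (c : S → S → G →₀ ℤ) (hanti : ∀ s t, c s t = - c t s) (hsum : ∀ s, ∑ t, c s t = 0)
    (hP : ∀ s t g, c s t g ≠ 0 → ∃ k : ℤ, k ≠ 0 ∧ c s t (g * γ s ^ k) ≠ 0) : ∀ s t, c s t = 0 := by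
  classical
  by_contra hcon
  push Not at hcon
  let T : Finset G := Finset.univ.biUnion (fun p : S × S => (c p.1 p.2).support)
  have hT : ∀ s t g, c s t g ≠ 0 → g ∈ T := by
    intro s t g h
    exact Finset.mem_biUnion.2 ⟨(s, t), Finset.mem_univ _, Finsupp.mem_support_iff.2 h⟩
  obtain ⟨s, t, hc⟩ := hcon
  obtain ⟨g0, hg0⟩ := Finsupp.ne_iff.1 hc
  obtain ⟨g, hgT, hmax⟩ := T.exists_max_image lam ⟨g0, hT s t g0 hg0⟩
  obtain ⟨⟨s, t⟩, -, hst⟩ := Finset.mem_biUnion.1 hgT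
  have hst : c s t g ≠ 0 := Finsupp.mem_support_iff.1 hst
  have key : ∀ s t, c s t g ≠ 0 → D g s := by
    intro s t h
    by_contra hn
    obtain ⟨k, hk, h'⟩ := hP s t g h
    have := hmax _ (hT s t _ h')
    have := hD g s k hk hn
    omega
  have anti : ∀ s t, c s t g = - c t s g := by
    intro s t
    rw [hanti s t]; rfl
  have sw : ∀ s t, c s t g ≠ 0 → c t s g ≠ 0 := by
    intro s t h h'
    rw [anti, h'] at h
    exact h neg_zero
  have dg : ∀ s, c s s g = 0 := by
    intro s
    have := anti s s
    omega
  have hne : ∀ s t, c s t g ≠ 0 → s ≠ t := by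
    rintro s t h rfl
    exact h (dg s)
  obtain ⟨r, hrt, hr⟩ : ∃ r, r ≠ t ∧ c s r g ≠ 0 := by
    by_contra hno
    push Not at hno
    have := DFunLike.congr_fun (hsum s) g
    rw [Finsupp.finset_sum_apply, Finset.sum_eq_single t (fun r _ hr => hno r hr) (by simp)] at this
    exact hst this
  exact h3 g s t r (hne _ _ hst) hrt.symm (hne _ _ hr) (key _ _ hst) (key _ _ (sw _ _ hst))
    (key _ _ (sw _ _ hr))

end Art


namespace GA

variable {G : Type*} [Group G]

/-- Group element in the integral group ring. -/
noncomputable def o (g : G) : MonoidAlgebra ℤ G := MonoidAlgebra.of ℤ G g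

lemma o_one : o (1 : G) = 1 := rfl

lemma o_mul (g h : G) : o (g * h) = o g * o h := map_mul (MonoidAlgebra.of ℤ G) g h

lemma o_mul_coeff (g h : G) (x : MonoidAlgebra ℤ G) : (o g * x).coeff h = x.coeff (g⁻¹ * h) := by
  have := MonoidAlgebra.coeff_single_mul_apply x (1 : ℤ) g h
  rw [one_mul] at this
  exact this

lemma mul_o_coeff (g h : G) (x : MonoidAlgebra ℤ G) : (x * o g).coeff h = x.coeff (h * g⁻¹) := by
  have := MonoidAlgebra.coeff_mul_single_apply x (1 : ℤ) g h
  rw [mul_one] at this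
  exact this

lemma const_zero {X : Type*} (f : X →₀ ℤ) (p : ℕ → X) (hp : Function.Injective p)
    (h : ∀ n, f (p (n + 1)) = f (p n)) : f (p 0) = 0 := by
  by_contra h0
  have h1 : ∀ n, f (p n) = f (p 0) := by
    intro n
    induction n with
    | zero => rfl
    | succ n ih => rw [h, ih]
  have h2 : Set.range p ⊆ (f.support : Set X) := by
    rintro _ ⟨n, rfl⟩
    simp only [Finset.mem_coe, Finsupp.mem_support_iff]
    rw [h1]; exact h0
  exact Set.infinite_range_of_injective hp (f.support.finite_toSet.subset h2)

lemma pow_inj' {s : G} (hs : ∀ k : ℤ, k ≠ 0 → s ^ k ≠ 1) {m n : ℤ} (h : s ^ m = s ^ n) : m = n := by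
  by_contra hne
  apply hs (m - n) (by omega)
  rw [zpow_sub, h, mul_inv_cancel]

lemma coset_lemma {s : G} (hs : ∀ k : ℤ, k ≠ 0 → s ^ k ≠ 1) (y : MonoidAlgebra ℤ G) (g : G)
    (hg : (y * (o s - 1)).coeff g ≠ 0) :
    ∃ k : ℤ, k ≠ 0 ∧ (y * (o s - 1)).coeff (g * s ^ k) ≠ 0 := by
  have hc : ∀ h, (y * (o s - 1)).coeff h = y.coeff (h * s⁻¹) - y.coeff h := by
    intro h
    rw [mul_sub, mul_one, MonoidAlgebra.coeff_sub, Finsupp.sub_apply, mul_o_coeff]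
  by_contra hcon
  push Not at hcon
  apply hg
  have h1 : ∀ k : ℤ, k ≠ 0 → y.coeff (g * s ^ k) = y.coeff (g * s ^ (k - 1)) := by
    intro k hk
    have := hcon k hk
    rw [hc, mul_assoc, ← zpow_sub_one] at this
    omega
  have a := const_zero y.coeff (fun n => g * s ^ (n : ℤ)) (by
    intro m n h
    have := pow_inj' hs (mul_left_cancel h)
    exact_mod_cast this) (by
    intro n
    have := h1 (n + 1) (by omega)
    rw [add_sub_cancel_right] at this
    exact_mod_cast this)
  have b := const_zero y.coeff (fun n => g * s ^ (-1 - n : ℤ)) (by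
    intro m n h
    have := pow_inj' hs (mul_left_cancel h)
    omega) (by
    intro n
    have := h1 (-1 - n) (by omega)
    rw [this]
    push_cast
    congr 3
    ring)
  rw [hc]
  simp at a b
  rw [a, b, sub_zero]

lemma mul_sub_one_eq_zero {s : G} (hs : ∀ k : ℤ, k ≠ 0 → s ^ k ≠ 1) (y : MonoidAlgebra ℤ G)
    (h : y * (o s - 1) = 0) : y = 0 := by
  rw [← MonoidAlgebra.coeff_inj]
  ext g
  have h1 : ∀ g, y.coeff (g * s⁻¹) = y.coeff g := by
    intro g
    rw [← mul_o_coeff]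
    rw [mul_sub, mul_one, sub_eq_zero] at h
    rw [h]
  have a := const_zero y.coeff (fun n => g * s ^ (n : ℤ)) (by
    intro m n h
    have := pow_inj' hs (mul_left_cancel h)
    exact_mod_cast this) (by
    intro n
    have := h1 (g * s ^ (n + 1 : ℤ))
    rw [mul_assoc, ← zpow_sub_one, add_sub_cancel_right] at this
    exact_mod_cast this.symm)
  simpa using a

/-- augmentation to right cosets -/
noncomputable def eps (H : Subgroup G) :
    MonoidAlgebra ℤ G →+ (Quotient (QuotientGroup.rightRel H) →₀ ℤ) :=
  (Finsupp.mapDomain.addMonoidHom (Quotient.mk _)).comp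
    (MonoidAlgebra.coeffAddEquiv (R := ℤ) (M := G)).toAddMonoidHom

lemma eps_single (H : Subgroup G) (g : G) (r : ℤ) :
    eps H (MonoidAlgebra.single g r) = Finsupp.single (Quotient.mk _ g) r := by
  show Finsupp.mapDomain _ (Finsupp.single g r) = _
  rw [Finsupp.mapDomain_single]

lemma o_mul_single (g h : G) (r : ℤ) :
    o g * MonoidAlgebra.single h r = MonoidAlgebra.single (g * h) r := by
  show MonoidAlgebra.single g 1 * MonoidAlgebra.single h r = _
  rw [MonoidAlgebra.single_mul_single, one_mul]

lemma eps_mul (H : Subgroup G) (b : G) (hb : b ∈ H) (y : MonoidAlgebra ℤ G) :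
    eps H (o b * y) = eps H y := by
  induction y using MonoidAlgebra.induction_linear with
  | zero => rw [mul_zero]
  | add x y hx hy => rw [mul_add, map_add, map_add, hx, hy]
  | single g r =>
    rw [o_mul_single, eps_single, eps_single]
    congr 1
    apply Quotient.sound
    show QuotientGroup.rightRel H _ _
    rw [QuotientGroup.rightRel_apply]
    simpa using hb

lemma eps_sub (H : Subgroup G) (b : G) (hb : b ∈ H) (y : MonoidAlgebra ℤ G) :
    eps H ((o b - 1) * y) = 0 := by
  rw [sub_mul, one_mul, map_sub, eps_mul H b hb, sub_self]

lemma eps_regular (H : Subgroup G) (a : G) (hc : ∀ h ∈ H, a * h = h * a)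
    (ha : ∀ k : ℤ, k ≠ 0 → a ^ k ∉ H) (x : MonoidAlgebra ℤ G)
    (hx : eps H ((o a - 1) * x) = 0) : eps H x = 0 := by
  have hrel : ∀ g g' : G, (Quotient.mk (QuotientGroup.rightRel H) g = Quotient.mk _ g') ↔
      g' * g⁻¹ ∈ H := by
    intro g g'
    rw [Quotient.eq]
    exact QuotientGroup.rightRel_apply
  let α : Quotient (QuotientGroup.rightRel H) → Quotient (QuotientGroup.rightRel H) :=
    Quotient.lift (fun g => Quotient.mk _ (a * g)) (by
      intro g g' h
      have h := (hrel g g').1 (Quotient.sound h)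
      rw [hrel]
      have := hc _ h
      have e : a * g' * (a * g)⁻¹ = a * (g' * g⁻¹) * a⁻¹ := by group
      rw [e, this, mul_inv_cancel_right]; exact h)
  have hα : ∀ g, α (Quotient.mk _ g) = Quotient.mk _ (a * g) := fun g => rfl
  have hinj : Function.Injective α := by
    intro p q
    induction p using Quotient.ind with | _ g =>
    induction q using Quotient.ind with | _ g' =>
    rw [hα, hα, hrel, hrel]
    intro h
    have := hc _ h
    have e : a * g' * (a * g)⁻¹ = a * (g' * g⁻¹) * a⁻¹ := by group
    have e2 : g' * g⁻¹ = a⁻¹ * (a * g' * (a * g)⁻¹) * a := by group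
    rw [e2, mul_assoc, ← this]
    simpa using h
  have hmap : ∀ x, eps H (o a * x) = Finsupp.mapDomain α (eps H x) := by
    intro y
    induction y using MonoidAlgebra.induction_linear with
    | zero => simp
    | add x y hx hy => rw [mul_add, map_add, map_add, hx, hy, Finsupp.mapDomain_add]
    | single g r =>
      rw [o_mul_single, eps_single, eps_single, Finsupp.mapDomain_single, hα]
  have hfix : ∀ q, eps H x (α q) = eps H x q := by
    intro q
    rw [sub_mul, one_mul, map_sub, sub_eq_zero, hmap] at hx
    have := Finsupp.mapDomain_apply hinj (eps H x) q
    rwa [hx] at this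
  ext q
  induction q using Quotient.ind with | _ g =>
  have a := const_zero (eps H x) (fun n => Quotient.mk _ (a ^ n * g)) (by
    intro m n h
    rw [hrel] at h
    have e : a ^ n * g * (a ^ m * g)⁻¹ = a ^ ((n : ℤ) - m) := by
      rw [zpow_sub, zpow_natCast, zpow_natCast]; group
    rw [e] at h
    by_contra hne
    exact ha _ (by omega) h) (by
    intro n
    have := hfix (Quotient.mk _ (a ^ n * g))
    rw [hα, ← mul_assoc, ← pow_succ'] at this
    exact this)
  simpa using a

lemma eps_zero (b c : G) (x : MonoidAlgebra ℤ G) (hx : eps (Subgroup.closure {b, c}) x = 0) :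
    ∃ u v, x = (o b - 1) * u + (o c - 1) * v := by
  let I : AddSubgroup (MonoidAlgebra ℤ G) :=
    (((AddMonoidHom.mulLeft (o b - 1)).coprod (AddMonoidHom.mulLeft (o c - 1)))).range
  have hI : ∀ x, x ∈ I ↔ ∃ u v, x = (o b - 1) * u + (o c - 1) * v := by
    intro x
    constructor
    · rintro ⟨⟨u, v⟩, rfl⟩
      exact ⟨u, v, rfl⟩
    · rintro ⟨u, v, rfl⟩
      exact ⟨⟨u, v⟩, rfl⟩
  have h1 : ∀ h ∈ Subgroup.closure {b, c}, ∀ y, (o h - 1) * y ∈ I := by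
    intro h hh
    induction hh using Subgroup.closure_induction with
    | mem h hh =>
      intro y
      rw [hI]
      rcases hh with rfl | rfl
      · exact ⟨y, 0, by simp⟩
      · exact ⟨0, y, by simp⟩
    | one => intro y; rw [o_one, sub_self, zero_mul]; exact I.zero_mem
    | mul h k _ _ ih ik =>
      intro y
      have : (o (h * k) - 1) * y = (o h - 1) * (o k * y) + (o k - 1) * y := by
        rw [o_mul]; noncomm_ring
      rw [this]
      exact I.add_mem (ih _) (ik _)
    | inv h _ ih =>
      intro y
      have : (o h⁻¹ - 1) * y = -((o h - 1) * (o h⁻¹ * y)) := by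
        rw [sub_mul _ _ (_ * y), ← mul_assoc, ← o_mul, mul_inv_cancel, o_one]; noncomm_ring
      rw [this]
      exact I.neg_mem (ih _)
  let rep : (Quotient (QuotientGroup.rightRel (Subgroup.closure {b, c})) →₀ ℤ) → MonoidAlgebra ℤ G :=
    fun e => MonoidAlgebra.ofCoeff (Finsupp.mapDomain Quotient.out e)
  have h2 : ∀ x, x - rep (eps (Subgroup.closure {b, c}) x) ∈ I := by
    intro y
    induction y using MonoidAlgebra.induction_linear with
    | zero =>
      have : (0 : MonoidAlgebra ℤ G) - rep (eps (Subgroup.closure {b, c}) 0) = 0 := by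
        simp [rep]
      rw [this]; exact I.zero_mem
    | add x y hx hy =>
      have : x + y - rep (eps (Subgroup.closure {b, c}) (x + y)) =
        (x - rep (eps (Subgroup.closure {b, c}) x)) + (y - rep (eps (Subgroup.closure {b, c}) y)) := by
        simp only [rep, map_add, Finsupp.mapDomain_add, MonoidAlgebra.ofCoeff_add]; abel
      rw [this]; exact I.add_mem hx hy
    | single g r =>
      have e : rep (eps (Subgroup.closure {b, c}) (MonoidAlgebra.single g r)) =
          MonoidAlgebra.single (Quotient.mk (QuotientGroup.rightRel (Subgroup.closure {b, c})) g).out r := by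
        simp only [rep, eps_single, Finsupp.mapDomain_single, MonoidAlgebra.ofCoeff_single]
      have hm : QuotientGroup.rightRel (Subgroup.closure {b, c})
        (Quotient.mk (QuotientGroup.rightRel (Subgroup.closure {b, c})) g).out g := Quotient.mk_out g
      rw [QuotientGroup.rightRel_apply] at hm
      rw [e]
      have := h1 _ hm (MonoidAlgebra.single
        (Quotient.mk (QuotientGroup.rightRel (Subgroup.closure {b, c})) g).out r)
      rwa [sub_mul, one_mul, o_mul_single, inv_mul_cancel_right] at this
  have := h2 x
  rw [hx] at this
  have e : rep 0 = 0 := by simp [rep]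
  rw [e, sub_zero] at this
  exact (hI x).1 this

end GA


namespace Fox
open GA

variable {G : Type*} [Group G] {S : Type*}

open Classical in
/-- The affine permutation attached to a generator. -/
noncomputable def aff (γ : S → G) (s : S) : Equiv.Perm ((S → MonoidAlgebra ℤ G) × G) where
  toFun p := (Pi.single s 1 + o (γ s) • p.1, γ s * p.2)
  invFun p := (o (γ s)⁻¹ • (p.1 - Pi.single s 1), (γ s)⁻¹ * p.2)
  left_inv p := by
    ext1
    · simp only [add_sub_cancel_left, smul_smul, ← o_mul, inv_mul_cancel, o_one, one_smul]
    · simp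
  right_inv p := by
    ext1
    · simp only [smul_smul, ← o_mul, mul_inv_cancel, o_one, one_smul, add_sub_cancel]
    · simp

/-- Fox derivative. -/
noncomputable def D (γ : S → G) (u : FreeGroup S) : S → MonoidAlgebra ℤ G :=
  (FreeGroup.lift (aff γ) u (0, 1)).1

variable (γ : S → G)

lemma lift_aff (u : FreeGroup S) : ∀ c g, FreeGroup.lift (aff γ) u (c, g) =
    (D γ u + o (FreeGroup.lift γ u) • c, FreeGroup.lift γ u * g) := by
  suffices h : ∃ d, ∀ c g, FreeGroup.lift (aff γ) u (c, g) =
    (d + o (FreeGroup.lift γ u) • c, FreeGroup.lift γ u * g) by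
    obtain ⟨d, hd⟩ := h
    have : D γ u = d := by rw [D, hd]; simp
    rw [this]; exact hd
  classical
  induction u using FreeGroup.induction_on with
  | C1 => exact ⟨0, fun c g => by simp [o_one]⟩
  | of s =>
    refine ⟨Pi.single s 1, fun c g => ?_⟩
    simp only [FreeGroup.lift_apply_of, aff, Equiv.coe_fn_mk]
  | inv_of s _ =>
    refine ⟨- (o (γ s)⁻¹ • Pi.single s 1), fun c g => ?_⟩
    simp only [map_inv, FreeGroup.lift_apply_of]
    rw [Equiv.Perm.inv_def]
    simp only [aff, Equiv.coe_fn_symm_mk, smul_sub]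
    ext1
    · simp only [neg_add_eq_sub]
    · rfl
  | mul u v hu hv =>
    obtain ⟨d, hd⟩ := hu
    obtain ⟨e, he⟩ := hv
    refine ⟨d + o (FreeGroup.lift γ u) • e, fun c g => ?_⟩
    rw [map_mul, Equiv.Perm.mul_apply, he, hd, map_mul, o_mul, smul_add, smul_smul, mul_assoc,
      add_assoc]

lemma D_mul (u v : FreeGroup S) : D γ (u * v) = D γ u + o (FreeGroup.lift γ u) • D γ v := by
  rw [D, map_mul, Equiv.Perm.mul_apply, lift_aff, lift_aff]
  simp

lemma D_one : D γ 1 = 0 := by simp [D]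

open Classical in
lemma D_of (s : S) : D γ (FreeGroup.of s) = Pi.single s 1 := by
  simp [D, aff]

lemma D_inv (u : FreeGroup S) : D γ u⁻¹ = - (o (FreeGroup.lift γ u)⁻¹ • D γ u) := by
  have := D_mul γ u⁻¹ u
  rw [inv_mul_cancel, D_one, map_inv] at this
  exact eq_neg_of_add_eq_zero_left this.symm

variable [Fintype S]

/-- Boundary. -/
noncomputable def d1 : (S → MonoidAlgebra ℤ G) →ₗ[MonoidAlgebra ℤ G] MonoidAlgebra ℤ G where
  toFun x := ∑ s, x s * (o (γ s) - 1)
  map_add' x y := by simp only [Pi.add_apply, add_mul, Finset.sum_add_distrib]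
  map_smul' r x := by
    simp only [Pi.smul_apply, smul_eq_mul, Finset.mul_sum, mul_assoc, RingHom.id_apply]

lemma d1_apply (x : S → MonoidAlgebra ℤ G) : d1 γ x = ∑ s, x s * (o (γ s) - 1) := rfl

lemma d1_D (u : FreeGroup S) : d1 γ (D γ u) = o (FreeGroup.lift γ u) - 1 := by
  classical
  induction u using FreeGroup.induction_on with
  | C1 => simp [D_one, o_one]
  | of s =>
    rw [D_of, d1_apply, Finset.sum_eq_single s]
    · simp
    · intro t _ ht
      rw [Pi.single_eq_of_ne ht, zero_mul]
    · simp
  | inv_of s hs =>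
    rw [D_inv, map_neg, map_smul, hs, map_inv, smul_eq_mul, mul_sub, ← o_mul, inv_mul_cancel, o_one]
    simp
  | mul u v hu hv =>
    rw [D_mul, map_add, map_smul, hu, hv, map_mul, o_mul, smul_eq_mul]
    noncomm_ring

/-- Degree filtration. -/
def Fk (deg : G →* Multiplicative ℤ) (k : ℤ) (x : MonoidAlgebra ℤ G) : Prop :=
  ∀ g, x.coeff g ≠ 0 → k ≤ Multiplicative.toAdd (deg g)

variable {deg : G →* Multiplicative ℤ}

lemma Fk.mono {k l : ℤ} {x : MonoidAlgebra ℤ G} (h : Fk deg k x) (hl : l ≤ k) : Fk deg l x :=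
  fun g hg => hl.trans (h g hg)

lemma Fk.zero {k : ℤ} : Fk deg k 0 := fun g hg => absurd rfl hg

lemma Fk.add {k : ℤ} {x y : MonoidAlgebra ℤ G} (h : Fk deg k x) (h' : Fk deg k y) :
    Fk deg k (x + y) := by
  intro g hg
  by_cases hx : x.coeff g = 0
  · apply h' g
    intro hy
    apply hg
    rw [MonoidAlgebra.coeff_add, Finsupp.add_apply, hx, hy, add_zero]
  · exact h g hx

lemma Fk.neg {k : ℤ} {x : MonoidAlgebra ℤ G} (h : Fk deg k x) : Fk deg k (-x) := by
  intro g hg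
  apply h g
  intro h0
  apply hg
  rw [MonoidAlgebra.coeff_neg, Finsupp.neg_apply, h0, neg_zero]

lemma Fk.o_mul {k : ℤ} {x : MonoidAlgebra ℤ G} {s : S} (hs : deg (γ s) = Multiplicative.ofAdd 1)
    (h : Fk deg k x) : Fk deg (k + 1) (o (γ s) * x) := by
  intro g hg
  rw [o_mul_coeff] at hg
  have := h _ hg
  rw [map_mul, map_inv, hs, toAdd_mul, toAdd_inv, toAdd_ofAdd] at this
  omega

lemma Fk.one : Fk deg 0 1 := by
  classical
  intro g hg
  rw [MonoidAlgebra.one_def, MonoidAlgebra.coeff_single_apply] at hg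
  have : 1 = g := by
    by_contra h
    rw [if_neg h] at hg
    exact hg rfl
  subst this
  simp

lemma Fk.mul {k l : ℤ} {x y : MonoidAlgebra ℤ G} (h : Fk deg k x) (h' : Fk deg l y) :
    Fk deg (k + l) (x * y) := by
  classical
  intro g hg
  rw [MonoidAlgebra.coeff_mul] at hg
  obtain ⟨a, ha, hg⟩ := Finset.exists_ne_zero_of_sum_ne_zero hg
  obtain ⟨b, hb, hg⟩ := Finset.exists_ne_zero_of_sum_ne_zero hg
  have e : a * b = g := by
    by_contra hne
    simp [hne] at hg
  rw [← e, map_mul, toAdd_mul]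
  exact add_le_add (h a (Finsupp.mem_support_iff.1 ha)) (h' b (Finsupp.mem_support_iff.1 hb))

lemma unit_like {z x : MonoidAlgebra ℤ G} (hz : Fk deg 1 z) (h : x * (1 + z) = 0) : x = 0 := by
  by_contra hx
  have hx' : x.coeff.support.Nonempty := by
    rw [Finsupp.support_nonempty_iff]
    simpa using hx
  obtain ⟨g, hg, hmin⟩ := x.coeff.support.exists_min_image
    (fun g => Multiplicative.toAdd (deg g)) hx'
  have hF : Fk deg (Multiplicative.toAdd (deg g)) x :=
    fun g' hg' => hmin g' (Finsupp.mem_support_iff.2 hg')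
  have h1 := hF.mul hz
  have h2 : x = - (x * z) := by
    rw [mul_add, mul_one] at h
    exact eq_neg_of_add_eq_zero_left h
  have h3 := h1.neg g (by rw [← h2]; exact Finsupp.mem_support_iff.1 hg)
  omega

lemma Fk_alt (hdeg : ∀ s, deg (γ s) = Multiplicative.ofAdd 1) (n : ℕ) : ∀ (s t a : S),
    Fk deg 0 (D γ (altWord (FreeGroup.of s) (FreeGroup.of t) n) a) := by
  classical
  induction n with
  | zero => intro s t a; rw [altWord, D_one]; exact Fk.zero
  | succ n ih =>
    intro s t a
    rw [altWord, D_mul, D_of, FreeGroup.lift_apply_of]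
    simp only [Pi.add_apply, Pi.smul_apply, smul_eq_mul]
    refine Fk.add ?_ ((Fk.o_mul γ (hdeg s) (ih t s a)).mono (by omega))
    by_cases h : a = s
    · subst h; rw [Pi.single_eq_same]; exact Fk.one
    · rw [Pi.single_eq_of_ne h]; exact Fk.zero

lemma alt_other (n : ℕ) : ∀ (s t a : S), a ≠ s → a ≠ t →
    D γ (altWord (FreeGroup.of s) (FreeGroup.of t) n) a = 0 := by
  classical
  induction n with
  | zero => intro s t a _ _; rw [altWord, D_one]; rfl
  | succ n ih =>
    intro s t a h1 h2
    rw [altWord, D_mul, D_of, FreeGroup.lift_apply_of]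
    simp only [Pi.add_apply, Pi.smul_apply, smul_eq_mul]
    rw [ih t s a h2 h1, Pi.single_eq_of_ne h1]
    simp

/-- The difference of derivatives of two sides of the relation. -/
noncomputable def rho (n : ℕ) (s t : S) : S → MonoidAlgebra ℤ G :=
  D γ (altWord (FreeGroup.of s) (FreeGroup.of t) n) -
    D γ (altWord (FreeGroup.of t) (FreeGroup.of s) n)

lemma rho_swap (n : ℕ) (s t : S) : rho γ n t s = - rho γ n s t := by
  simp [rho]

lemma rho_other (n : ℕ) (s t a : S) (h1 : a ≠ s) (h2 : a ≠ t) : rho γ n s t a = 0 := by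
  simp [rho, alt_other γ n s t a h1 h2, alt_other γ n t s a h2 h1]

lemma rho_unit (hdeg : ∀ s, deg (γ s) = Multiplicative.ofAdd 1) (n : ℕ) (hn : n ≠ 0) (s t : S)
    (hst : s ≠ t) (x : MonoidAlgebra ℤ G) (h : x * rho γ n s t s = 0) : x = 0 := by
  classical
  obtain ⟨n, rfl⟩ := Nat.exists_eq_succ_of_ne_zero hn
  have : rho γ (n + 1) s t s = 1 + (o (γ s) * D γ (altWord (FreeGroup.of t) (FreeGroup.of s) n) s
    + - (o (γ t) * D γ (altWord (FreeGroup.of s) (FreeGroup.of t) n) s)) := by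
    rw [rho, altWord, altWord, D_mul, D_mul, D_of, D_of]
    simp only [Pi.add_apply, Pi.sub_apply, Pi.smul_apply, smul_eq_mul, Pi.single_eq_same,
      Pi.single_eq_of_ne hst, FreeGroup.lift_apply_of]
    abel
  rw [this] at h
  refine unit_like (deg := deg) ?_ h
  exact ((Fk.o_mul γ (hdeg s) (Fk_alt γ hdeg n t s s)).add
    (Fk.o_mul γ (hdeg t) (Fk_alt γ hdeg n s t s)).neg).mono (by omega)

lemma rho_bd (n : ℕ) (s t : S) (hst : s ≠ t)
    (h : altWord (γ s) (γ t) n = altWord (γ t) (γ s) n) :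
    rho γ n s t s * (o (γ s) - 1) = rho γ n t s t * (o (γ t) - 1) := by
  classical
  have h1 : d1 γ (rho γ n s t) = 0 := by
    rw [rho, map_sub, d1_D, d1_D, map_altWord, map_altWord]
    simp [h]
  rw [d1_apply, Finset.sum_eq_add_of_mem s t (Finset.mem_univ _) (Finset.mem_univ _) hst] at h1
  · rw [rho_swap γ n s t, Pi.neg_apply, neg_mul]
    exact eq_neg_of_add_eq_zero_left h1
  · rintro a - ⟨h1, h2⟩
    rw [rho_other γ n s t a h1 h2, zero_mul]

end Fox


namespace Art
open GA Fox

variable {S : Type*} [Fintype S] {M : S → S → ℕ∞}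

lemma gen_rel (s t : S) (hst : s ≠ t) (n : ℕ) (h : M s t = n) :
    altWord (gen M s) (gen M t) n = altWord (gen M t) (gen M s) n := by
  have h1 : PresentedGroup.mk (artinRels M) (altWord (FreeGroup.of s) (FreeGroup.of t) n *
        (altWord (FreeGroup.of t) (FreeGroup.of s) n)⁻¹) = 1 :=
    PresentedGroup.one_of_mem ⟨s, t, hst, n, h, rfl⟩
  rw [map_mul, map_inv, map_altWord, map_altWord, mul_inv_eq_one] at h1
  exact h1

lemma lift_gen : FreeGroup.lift (gen M) = PresentedGroup.mk (artinRels M) := by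
  ext s
  simp [gen, PresentedGroup.of]

/-- Degree homomorphism. -/
noncomputable def deg (M : S → S → ℕ∞) : ArtinGroup M →* Multiplicative ℤ :=
  PresentedGroup.toGroup (f := fun _ => Multiplicative.ofAdd (1 : ℤ))
    (altWord_of (M := M) _ (fun _ _ _ _ _ => rfl))

lemma deg_gen (s : S) : deg M (gen M s) = Multiplicative.ofAdd 1 :=
  PresentedGroup.toGroup.of _

lemma gen_inf (s : S) : ∀ k : ℤ, k ≠ 0 → gen M s ^ k ≠ 1 := by
  intro k hk h
  have := congrArg (deg M) h
  rw [map_zpow, deg_gen, map_one (deg M), ← ofAdd_zsmul] at this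
  have := congrArg Multiplicative.toAdd this
  simp at this
  exact hk this

/-- Coefficients of the boundary. -/
noncomputable def q (M : S → S → ℕ∞) (s t : S) : MonoidAlgebra ℤ (ArtinGroup M) :=
  rho (gen M) (M s t).toNat s t s

lemma q_self (s : S) : q M s s = 0 := by simp [q, rho]

lemma q_top (s t : S) (h : M s t = ⊤) : q M s t = 0 := by
  rw [q, h]
  simp [rho, altWord]

lemma q_symm (hsymm : ∀ a b : S, M a b = M b a) (s t : S) :
    q M s t * (o (gen M s) - 1) = q M t s * (o (gen M t) - 1) := by
  by_cases hst : s = t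
  · subst hst; rfl
  by_cases h : M s t = ⊤
  · rw [q_top s t h, q_top t s (by rw [hsymm, h]), zero_mul, zero_mul]
  · rw [q, q, hsymm t s]
    exact rho_bd _ _ s t hst (gen_rel s t hst _ (ENat.coe_toNat h).symm)

/-- Second boundary. -/
noncomputable def d2 (M : S → S → ℕ∞) : (S → S → MonoidAlgebra ℤ (ArtinGroup M))
    →ₗ[MonoidAlgebra ℤ (ArtinGroup M)] (S → MonoidAlgebra ℤ (ArtinGroup M)) where
  toFun x := fun s => ∑ t, x s t * q M s t
  map_add' x y := by
    ext1 s; simp only [Pi.add_apply, add_mul, Finset.sum_add_distrib]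
  map_smul' r x := by
    ext1 s; simp only [Pi.smul_apply, smul_eq_mul, Finset.mul_sum, mul_assoc, RingHom.id_apply]

lemma d2_apply (x : S → S → MonoidAlgebra ℤ (ArtinGroup M)) (s : S) :
    d2 M x s = ∑ t, x s t * q M s t := rfl

/-- Two-chains. -/
def C2 (M : S → S → ℕ∞) : Submodule (MonoidAlgebra ℤ (ArtinGroup M))
    (S → S → MonoidAlgebra ℤ (ArtinGroup M)) where
  carrier := {x | (∀ s t, x s t = - x t s) ∧ ∀ s t, (s = t ∨ M s t = ⊤) → x s t = 0}
  add_mem' := by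
    rintro x y ⟨h1, h2⟩ ⟨h3, h4⟩
    refine ⟨fun s t => ?_, fun s t h => ?_⟩
    · simp only [Pi.add_apply, h1 s t, h3 s t, neg_add]
    · simp only [Pi.add_apply, h2 s t h, h4 s t h, add_zero]
  zero_mem' := ⟨fun s t => by simp, fun s t _ => rfl⟩
  smul_mem' := by
    rintro r x ⟨h1, h2⟩
    refine ⟨fun s t => ?_, fun s t h => ?_⟩
    · simp only [Pi.smul_apply, h1 s t, smul_neg]
    · simp only [Pi.smul_apply, h2 s t h, smul_zero]

lemma d1_d2 (hsymm : ∀ a b : S, M a b = M b a) (x : S → S → MonoidAlgebra ℤ (ArtinGroup M))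
    (hx : ∀ s t, x s t = - x t s) : d1 (gen M) (d2 M x) = 0 := by
  have e : d1 (gen M) (d2 M x) = - d1 (gen M) (d2 M x) := by
    conv_lhs => rw [d1_apply]
    rw [d1_apply]
    simp only [d2_apply, Finset.sum_mul]
    conv_lhs => rw [Finset.sum_comm]
    rw [← Finset.sum_neg_distrib]
    refine Finset.sum_congr rfl fun s _ => ?_
    rw [← Finset.sum_neg_distrib]
    refine Finset.sum_congr rfl fun t _ => ?_
    rw [mul_assoc, mul_assoc, q_symm hsymm t s, hx t s, neg_mul]
  rw [← MonoidAlgebra.coeff_inj]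
  ext g
  have := congrArg (fun y => y.coeff g) e
  simp only [MonoidAlgebra.coeff_neg, Finsupp.neg_apply] at this
  simp only [MonoidAlgebra.coeff_zero, Finsupp.coe_zero, Pi.zero_apply]
  omega

theorem d2_inj (hsymm : ∀ a b : S, M a b = M b a) (htwo : ∀ a b : S, a ≠ b → 2 ≤ M a b)
    (h2dim : TwoDimensional M) (x : S → S → MonoidAlgebra ℤ (ArtinGroup M)) (hx : x ∈ C2 M)
    (h0 : d2 M x = 0) : x = 0 := by
  obtain ⟨lam, D, hD, h3⟩ := exists_level hsymm htwo h2dim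
  obtain ⟨hx1, hx2⟩ := hx
  have key := vanish (gen M) lam D hD h3
    (fun s t => (x s t * q M s t * (o (gen M s) - 1)).coeff) (by
      intro s t
      rw [← MonoidAlgebra.coeff_neg]
      congr 1
      rw [mul_assoc, mul_assoc, q_symm hsymm s t, hx1 s t, neg_mul]) (by
      intro s
      rw [← MonoidAlgebra.coeff_sum, ← Finset.sum_mul]
      have := congrFun h0 s
      rw [d2_apply] at this
      rw [this]
      simp) (by
      intro s t g hg
      exact coset_lemma (gen_inf s) _ g hg)
  funext s t
  by_cases hc : s = t ∨ M s t = ⊤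
  · exact hx2 s t hc
  push Not at hc
  have h1 := key s t
  rw [MonoidAlgebra.coeff_eq_zero] at h1
  have h2 := mul_sub_one_eq_zero (gen_inf s) _ h1
  refine rho_unit (gen M) deg_gen _ ?_ s t hc.1 _ h2
  intro h
  rw [ENat.toNat_eq_zero] at h
  rcases h with h | h
  · have := htwo s t hc.1
    rw [h] at this
    simp at this
  · exact hc.2 h

lemma D_sub (u v : FreeGroup S) (h : FreeGroup.lift (gen M) u = FreeGroup.lift (gen M) v) :
    D (gen M) (u * v⁻¹) = D (gen M) u - D (gen M) v := by
  rw [D_mul, D_inv, smul_neg, smul_smul, ← o_mul, h, mul_inv_cancel, o_one, one_smul, sub_eq_add_neg]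

lemma rho_mem (hsymm : ∀ a b : S, M a b = M b a) (s t : S) (hst : s ≠ t) (n : ℕ) (hn : M s t = n) :
    ∃ x ∈ C2 M, rho (gen M) n s t = d2 M x := by
  classical
  refine ⟨Pi.single s (Pi.single t 1) - Pi.single t (Pi.single s 1), ⟨?_, ?_⟩, ?_⟩
  · intro a b
    simp only [Pi.sub_apply]
    by_cases h1 : a = s <;> by_cases h2 : a = t <;> by_cases h3 : b = s <;> by_cases h4 : b = t <;>
      simp_all [Pi.single_apply]
  · rintro a b (rfl | h)
    · simp only [Pi.sub_apply]
      by_cases h1 : a = s <;> by_cases h2 : a = t <;> simp_all [Pi.single_apply]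
    · have h5 : ¬ (a = s ∧ b = t) := by
        rintro ⟨rfl, rfl⟩
        rw [h] at hn
        exact ENat.top_ne_coe _ hn
      have h6 : ¬ (a = t ∧ b = s) := by
        rintro ⟨rfl, rfl⟩
        rw [hsymm, hn] at h
        exact ENat.coe_ne_top _ h
      simp only [Pi.sub_apply]
      by_cases h1 : a = s <;> by_cases h2 : a = t <;> simp_all [Pi.single_apply]
  · have e : ∀ s t, d2 M (Pi.single s (Pi.single t 1)) = Pi.single s (q M s t) := by
      intro s t
      ext1 a
      rw [d2_apply]
      by_cases h : a = s
      · subst h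
        rw [Pi.single_eq_same, Pi.single_eq_same, Finset.sum_eq_single t]
        · simp
        · intro b _ hb; rw [Pi.single_eq_of_ne hb, zero_mul]
        · simp
      · rw [Pi.single_eq_of_ne h, Pi.single_eq_of_ne h]
        simp
    rw [map_sub, e, e]
    have hn' : (M s t).toNat = n := by rw [hn]; rfl
    have hn2 : (M t s).toNat = n := by rw [hsymm, hn]; rfl
    rw [q, q, hn', hn2]
    ext1 a
    by_cases h1 : a = s
    · subst h1
      simp [Pi.single_apply, hst]
    · by_cases h2 : a = t
      · subst h2
        rw [rho_swap (gen M) n s a]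
        simp [Pi.single_apply, h1]
      · rw [rho_other _ _ _ _ _ h1 h2]
        simp [Pi.single_apply, h1, h2]

lemma ker_mem (hsymm : ∀ a b : S, M a b = M b a) (u : FreeGroup S)
    (hu : FreeGroup.lift (gen M) u = 1) : ∃ x ∈ C2 M, D (gen M) u = d2 M x := by
  rw [lift_gen] at hu
  replace hu : u ∈ Subgroup.closure (Group.conjugatesOfSet (artinRels M)) :=
    PresentedGroup.mk_eq_one_iff.1 hu
  suffices h : FreeGroup.lift (gen M) u = 1 ∧ ∃ x ∈ C2 M, D (gen M) u = d2 M x from h.2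
  induction hu using Subgroup.closure_induction with
  | mem u hu =>
    obtain ⟨r, hr, hu⟩ := Group.mem_conjugatesOfSet_iff.1 hu
    obtain ⟨w, rfl⟩ := isConj_iff.1 hu
    have hr1 : FreeGroup.lift (gen M) r = 1 := by
      rw [lift_gen]; exact PresentedGroup.one_of_mem hr
    refine ⟨by simp [hr1], ?_⟩
    obtain ⟨s, t, hst, n, hn, rfl⟩ := hr
    obtain ⟨x, hx, e⟩ := rho_mem hsymm s t hst n hn
    refine ⟨o (FreeGroup.lift (gen M) w) • x, (C2 M).smul_mem _ hx, ?_⟩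
    rw [D_sub _ w (by rw [map_mul, hr1, mul_one]), D_mul, map_smul, ← e, D_sub, rho]
    · abel
    · rwa [map_mul, map_inv, mul_inv_eq_one] at hr1
  | one => exact ⟨map_one _, 0, (C2 M).zero_mem, by rw [D_one, map_zero]⟩
  | mul u v _ _ hu hv =>
    obtain ⟨hu, x, hx, ex⟩ := hu
    obtain ⟨hv, y, hy, ey⟩ := hv
    refine ⟨by rw [map_mul, hu, hv, mul_one], x + y, (C2 M).add_mem hx hy, ?_⟩
    rw [D_mul, hu, o_one, one_smul, map_add, ex, ey]
  | inv u _ hu =>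
    obtain ⟨hu, x, hx, ex⟩ := hu
    refine ⟨by rw [map_inv, hu, inv_one], -x, (C2 M).neg_mem hx, ?_⟩
    rw [D_inv, hu, inv_one, o_one, one_smul, map_neg, ex]

lemma comm_mem (hsymm : ∀ a b : S, M a b = M b a) (u v : FreeGroup S)
    (h : FreeGroup.lift (gen M) u * FreeGroup.lift (gen M) v =
      FreeGroup.lift (gen M) v * FreeGroup.lift (gen M) u) :
    ∃ x ∈ C2 M, (o (FreeGroup.lift (gen M) u) - 1) • D (gen M) v -
      (o (FreeGroup.lift (gen M) v) - 1) • D (gen M) u = d2 M x := by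
  obtain ⟨x, hx, e⟩ := ker_mem hsymm (u * v * (v * u)⁻¹) (by
    rw [map_mul, map_inv, map_mul, map_mul, h, mul_inv_cancel])
  refine ⟨x, hx, ?_⟩
  rw [← e, D_sub _ _ (by rw [map_mul, map_mul, h]), D_mul, D_mul, sub_smul, sub_smul, one_smul, one_smul]
  abel

theorem main (hsymm : ∀ a b : S, M a b = M b a) (htwo : ∀ a b : S, a ≠ b → 2 ≤ M a b)
    (h2dim : TwoDimensional M) (a b c : ArtinGroup M) (hab : a * b = b * a) (hac : a * c = c * a)
    (hbc : b * c = c * b)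
    (h1 : ∀ k : ℤ, k ≠ 0 → a ^ k ∉ Subgroup.closure {b, c})
    (h2 : ∀ k : ℤ, k ≠ 0 → c ^ k ∉ Subgroup.closure {b, b})
    (h3 : ∀ k : ℤ, k ≠ 0 → b ^ k ∉ Subgroup.closure {(1 : ArtinGroup M), 1}) : False := by
  have hcl : ∀ x y z : ArtinGroup M, x * y = y * x → x * z = z * x →
      ∀ h ∈ Subgroup.closure {y, z}, x * h = h * x := by
    intro x y z hy hz h hh
    have : Subgroup.closure {y, z} ≤ Subgroup.centralizer {x} := by
      rw [Subgroup.closure_le]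
      rintro w (rfl | rfl)
      · rw [SetLike.mem_coe, Subgroup.mem_centralizer_singleton_iff]; exact hy.symm
      · rw [SetLike.mem_coe, Subgroup.mem_centralizer_singleton_iff]; exact hz.symm
    exact (Subgroup.mem_centralizer_singleton_iff.1 (this hh)).symm
  have surj : ∀ g : ArtinGroup M, ∃ u, FreeGroup.lift (gen M) u = g := by
    rw [lift_gen]; exact PresentedGroup.mk_surjective _
  obtain ⟨ua, ea⟩ := surj a
  obtain ⟨ub, eb⟩ := surj b
  obtain ⟨uc, ec⟩ := surj c
  obtain ⟨Dbc, mbc, ebc⟩ := comm_mem hsymm ub uc (by rw [eb, ec, hbc])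
  obtain ⟨Dac, mac, eac⟩ := comm_mem hsymm ua uc (by rw [ea, ec, hac])
  obtain ⟨Dab, mab, eab⟩ := comm_mem hsymm ua ub (by rw [ea, eb, hab])
  have dB := d1_D (gen M) ub
  rw [eb] at dB
  rw [eb, ec] at ebc
  rw [ea, ec] at eac
  rw [ea, eb] at eab
  generalize D (gen M) ua = A at *
  generalize D (gen M) ub = B at *
  generalize D (gen M) uc = C at *
  have cab : (o a - 1) * (o b - 1) = (o b - 1) * (o a - 1) := by
    have := congrArg o hab
    rw [o_mul, o_mul] at this
    simp only [sub_mul, mul_sub, this]; noncomm_ring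
  have cac : (o a - 1) * (o c - 1) = (o c - 1) * (o a - 1) := by
    have := congrArg o hac
    rw [o_mul, o_mul] at this
    simp only [sub_mul, mul_sub, this]; noncomm_ring
  have cbc : (o b - 1) * (o c - 1) = (o c - 1) * (o b - 1) := by
    have := congrArg o hbc
    rw [o_mul, o_mul] at this
    simp only [sub_mul, mul_sub, this]; noncomm_ring
  have hz := d2_inj hsymm htwo h2dim ((o a - 1) • Dbc - (o b - 1) • Dac + (o c - 1) • Dab)
    ((C2 M).add_mem ((C2 M).sub_mem ((C2 M).smul_mem _ mbc) ((C2 M).smul_mem _ mac))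
      ((C2 M).smul_mem _ mab)) (by
    rw [map_add, map_sub, map_smul, map_smul, map_smul, ← ebc, ← eac, ← eab]
    simp only [smul_sub, smul_smul, cab, cac, cbc]
    abel)
  have hex : ∀ s t, ∃ u v, Dbc s t = (o b - 1) * u + (o c - 1) * v := by
    intro s t
    apply eps_zero
    apply eps_regular _ a (hcl a b c hab hac) h1
    have : (o a - 1) * Dbc s t = (o b - 1) * Dac s t - (o c - 1) * Dab s t := by
      have := congrFun (congrFun hz s) t
      simp only [Pi.add_apply, Pi.sub_apply, Pi.smul_apply, smul_eq_mul, Pi.zero_apply] at this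
      rw [sub_add, sub_eq_zero] at this
      exact this
    rw [this, map_sub, eps_sub _ b (Subgroup.subset_closure (by simp)),
      eps_sub _ c (Subgroup.subset_closure (by simp)), sub_zero]
  choose u0 v0 huv using hex
  let en := Fintype.equivFin S
  let anti : (S → S → MonoidAlgebra ℤ (ArtinGroup M)) → S → S → MonoidAlgebra ℤ (ArtinGroup M) :=
    fun f s t => if en s < en t then f s t else if en t < en s then - f t s else 0
  have hanti : ∀ f s t, anti f s t = - anti f t s := by
    intro f s t
    simp only [anti]
    rcases lt_trichotomy (en s) (en t) with h | h | h
    · rw [if_pos h, if_neg h.not_gt, if_pos h, neg_neg]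
    · rw [h]; simp
    · rw [if_neg h.not_gt, if_pos h, if_pos h]
  have hD : Dbc = (o b - 1) • anti u0 + (o c - 1) • anti v0 := by
    funext s t
    simp only [Pi.add_apply, Pi.smul_apply, smul_eq_mul, anti]
    rcases lt_trichotomy (en s) (en t) with h | h | h
    · rw [if_pos h, if_pos h, huv]
    · have : s = t := en.injective h
      subst this
      simp [mbc.2 s s (Or.inl rfl)]
    · rw [if_neg h.not_gt, if_pos h, if_neg h.not_gt, if_pos h, mbc.1 s t, huv, neg_add, mul_neg, mul_neg]
  have hY : (o c - 1) • (B + d2 M (anti v0)) = (o b - 1) • (C - d2 M (anti u0)) := by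
    rw [hD, map_add, map_smul, map_smul, sub_eq_iff_eq_add] at ebc
    rw [smul_add, smul_sub, ebc]
    abel
  have hex2 : ∀ s, ∃ β, (B + d2 M (anti v0)) s = (o b - 1) * β := by
    intro s
    obtain ⟨u, v, e⟩ := eps_zero b b ((B + d2 M (anti v0)) s) (by
      apply eps_regular _ c (hcl c b b hbc.symm hbc.symm) h2
      have := congrFun hY s
      rw [Pi.smul_apply, Pi.smul_apply, smul_eq_mul, smul_eq_mul] at this
      rw [this, eps_sub _ b (Subgroup.subset_closure (by simp))])
    exact ⟨u + v, by rw [e, mul_add]⟩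
  choose β hβ using hex2
  have hβ : B + d2 M (anti v0) = (o b - 1) • β := funext hβ
  have h5 := congrArg (d1 (gen M)) hβ
  rw [map_add, map_smul, d1_d2 hsymm _ (hanti v0), add_zero, dB, smul_eq_mul] at h5
  have h6 : d1 (gen M) β - 1 = 0 := by
    obtain ⟨u, v, e⟩ := eps_zero 1 1 (d1 (gen M) β - 1) (by
      apply eps_regular _ b (hcl b 1 1 (by simp) (by simp)) h3
      rw [mul_sub, mul_one, ← h5, sub_self, map_zero])
    rw [e, o_one]; simp
  let aug : MonoidAlgebra ℤ (ArtinGroup M) →ₐ[ℤ] ℤ :=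
    MonoidAlgebra.lift ℤ ℤ (ArtinGroup M) (1 : ArtinGroup M →* ℤ)
  have haug : ∀ g, aug (o g) = 1 := by
    intro g
    simp [aug, o]
  have h7 : aug (d1 (gen M) β) = 0 := by
    rw [d1_apply, map_sum]
    apply Finset.sum_eq_zero
    intro s _
    rw [map_mul, map_sub, haug, map_one, sub_self, mul_zero]
  rw [sub_eq_zero.1 h6, map_one] at h7
  exact one_ne_zero h7

end Art

theorem artin_twoDimensional_no_Z3 {S : Type*} [Fintype S] (M : S → S → ℕ∞)
    (hsymm : ∀ a b : S, M a b = M b a) (htwo : ∀ a b : S, a ≠ b → 2 ≤ M a b)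
    (h2dim : TwoDimensional M) :
    ¬ ∃ f : Multiplicative (ℤ × ℤ × ℤ) →* ArtinGroup M, Function.Injective f := by
  rintro ⟨f, hf⟩
  have hcomm : ∀ x y, f x * f y = f y * f x := by
    intro x y
    rw [← map_mul, ← map_mul, mul_comm]
  have key : ∀ (p : Multiplicative (ℤ × ℤ × ℤ) →* Multiplicative ℤ) (x y z), p y = 1 → p z = 1 →
      p x = Multiplicative.ofAdd 1 →
      ∀ k : ℤ, k ≠ 0 → f x ^ k ∉ Subgroup.closure {f y, f z} := by
    intro p x y z hy hz hx k hk hmem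
    have e : ({f y, f z} : Set (ArtinGroup M)) = f '' {y, z} := by
      rw [Set.image_pair]
    rw [e, ← MonoidHom.map_closure] at hmem
    obtain ⟨w, hw, hw2⟩ := hmem
    have hle : Subgroup.closure {y, z} ≤ p.ker := by
      rw [Subgroup.closure_le]
      rintro v (rfl | rfl)
      · exact hy
      · exact hz
    have h1 : p w = 1 := hle hw
    rw [← map_zpow] at hw2
    have h2 := hf hw2
    rw [h2, map_zpow, hx, ← ofAdd_zsmul] at h1
    have := congrArg Multiplicative.toAdd h1
    simp at this
    exact hk this
  let p1 : Multiplicative (ℤ × ℤ × ℤ) →* Multiplicative ℤ := AddMonoidHom.toMultiplicative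
    (AddMonoidHom.fst ℤ (ℤ × ℤ))
  let p2 : Multiplicative (ℤ × ℤ × ℤ) →* Multiplicative ℤ := AddMonoidHom.toMultiplicative
    ((AddMonoidHom.fst ℤ ℤ).comp (AddMonoidHom.snd ℤ (ℤ × ℤ)))
  let p3 : Multiplicative (ℤ × ℤ × ℤ) →* Multiplicative ℤ := AddMonoidHom.toMultiplicative
    ((AddMonoidHom.snd ℤ ℤ).comp (AddMonoidHom.snd ℤ (ℤ × ℤ)))
  let a : Multiplicative (ℤ × ℤ × ℤ) := Multiplicative.ofAdd (1, 0, 0)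
  let b : Multiplicative (ℤ × ℤ × ℤ) := Multiplicative.ofAdd (0, 1, 0)
  let c : Multiplicative (ℤ × ℤ × ℤ) := Multiplicative.ofAdd (0, 0, 1)
  refine Art.main hsymm htwo h2dim (f a) (f b) (f c) (hcomm _ _) (hcomm _ _) (hcomm _ _)
    (key p1 a b c rfl rfl rfl) (key p3 c b b rfl rfl rfl) ?_
  have := key p2 b 1 1 rfl rfl rfl
  rwa [map_one] at this
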